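/- arXiv:2010.01629 — 6 statements merged into one kernel-verified Lean document; each statement's English description precedes it below -/
import Mathlib

section
/- Let Y be a simple kG-module for which there exists a surjective kG-module homomorphism from the permutation module k[G/B] onto Y, and let V be a simple kG-module that is not a composition factor of k[G/B], i.e., there exist no kG-submodules N ⊆ N' of k[G/B] with N'/N isomorphic to V. Then Ext^1_{kG}(Y, V) = 0. -/
open CategoryTheory

noncomputable section

/-- The Borel subgroup of upper-triangular invertible matrices in `GL n F`. -/
def upperTriangularSubgroup (n : ℕ) (F : Type) [Field F] :
    Subgroup (GL (Fin n) F) where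
  carrier := {g | Matrix.BlockTriangular (g : Matrix (Fin n) (Fin n) F) id}
  mul_mem' := by
    intro a b ha hb
    simpa [Units.val_mul] using ha.mul hb
  one_mem' := by
    simpa using Matrix.blockTriangular_one
  inv_mem' := by
    intro g hg
    letI := g.invertible
    simpa [Matrix.coe_units_inv] using Matrix.blockTriangular_inv_of_blockTriangular hg

/-- The permutation module `k[G/B]`, as a module over the group algebra
`MonoidAlgebra k G`. -/
abbrev permutationModule (k : Type) [Field k] {G : Type} [Group G] (B : Subgroup G) :=
  (Representation.ofMulAction k G (G ⧸ B)).asModule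

/-- In a three-term piece `X₂ ⟶ X₁ ⟶ X₀ ⟶ Y` of a projective resolution, every morphism
`X₁ ⟶ V` killed by `X₂ ⟶ X₁` extends to `X₀`, as soon as `Y` is the quotient of a projective
object `P` by a subobject admitting only the zero morphism to `V`. -/
lemma exists_comp_eq_of_kernel_hom_eq_zero {C : Type*} [Category* C] [Abelian C]
    {X₀ X₁ X₂ P Y V : C} [Projective X₀] [Projective P]
    {d₂ : X₂ ⟶ X₁} {d₁ : X₁ ⟶ X₀} {ε : X₀ ⟶ Y} [Epi ε]
    {w₁ : d₂ ≫ d₁ = 0} {w₀ : d₁ ≫ ε = 0}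
    (h₁ : (ShortComplex.mk d₂ d₁ w₁).Exact) (h₀ : (ShortComplex.mk d₁ ε w₀).Exact)
    (p : P ⟶ Y) (hp : Epi p) (hV : ∀ f : Limits.kernel p ⟶ V, f = 0)
    (x : X₁ ⟶ V) (hx : d₂ ≫ x = 0) : ∃ y : X₀ ⟶ V, d₁ ≫ y = x := by
  let e : X₁ ⟶ Limits.kernel ε := Limits.kernel.lift ε d₁ w₀
  have he : e ≫ Limits.kernel.ι ε = d₁ := Limits.kernel.lift_ι _ _ _
  have : Epi e := h₀.epi_kernelLift
  have we : d₂ ≫ e = 0 := by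
    rw [← cancel_mono (Limits.kernel.ι ε), Category.assoc, he, w₁, Limits.zero_comp]
  have hexact : (ShortComplex.mk d₂ e we).Exact := by
    let φ : ShortComplex.mk d₂ e we ⟶ ShortComplex.mk d₂ d₁ w₁ :=
      { τ₁ := 𝟙 _, τ₂ := 𝟙 _, τ₃ := Limits.kernel.ι ε }
    have : Epi φ.τ₁ := inferInstanceAs (Epi (𝟙 X₂))
    have : IsIso φ.τ₂ := inferInstanceAs (IsIso (𝟙 X₁))
    have : Mono φ.τ₃ := inferInstanceAs (Mono (Limits.kernel.ι ε))
    exact (ShortComplex.exact_iff_of_epi_of_isIso_of_mono φ).2 h₁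
  let f : Limits.kernel ε ⟶ V := hexact.desc x hx
  have hf : e ≫ f = x := hexact.g_desc x hx
  let a : X₀ ⟶ P := Projective.factorThru ε p
  have ha : a ≫ p = ε := Projective.factorThru_comp _ _
  let b : P ⟶ X₀ := Projective.factorThru p ε
  have hb : b ≫ ε = p := Projective.factorThru_comp _ _
  let c : X₀ ⟶ Limits.kernel ε := Limits.kernel.lift ε (𝟙 X₀ - a ≫ b) (by simp [ha, hb])
  let a' : Limits.kernel ε ⟶ Limits.kernel p :=
    Limits.kernel.lift p (Limits.kernel.ι ε ≫ a) (by simp [ha])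
  let b' : Limits.kernel p ⟶ Limits.kernel ε :=
    Limits.kernel.lift ε (Limits.kernel.ι p ≫ b) (by simp [hb])
  have hc : Limits.kernel.ι ε ≫ c = 𝟙 _ - a' ≫ b' := by
    rw [← cancel_mono (Limits.kernel.ι ε)]
    simp [a', b', c]
  refine ⟨c ≫ f, ?_⟩
  rw [← he, Category.assoc, ← Category.assoc _ c, hc, Preadditive.sub_comp, Category.assoc,
    hV (b' ≫ f), Limits.comp_zero, sub_zero, Category.id_comp, hf]

/-- If `Y` is the quotient of a projective object by a subobject admitting only the zero morphism
to `V`, then `Ext¹(Y, V)` vanishes. -/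
lemma isZero_ext_one_of_kernel_hom_eq_zero {R C : Type*} [Ring R] [Category* C] [Abelian C]
    [Linear R C] [EnoughProjectives C] {P Y V : C} [Projective P] (p : P ⟶ Y) [Epi p]
    (hV : ∀ f : Limits.kernel p ⟶ V, f = 0) :
    Limits.IsZero (((Ext R C 1).obj (Opposite.op Y)).obj V) := by
  let Q := ProjectiveResolution.of Y
  refine Limits.IsZero.of_iso ?_ (Q.isoExt 1 V)
  rw [← HomologicalComplex.exactAt_iff_isZero_homology,
    HomologicalComplex.exactAt_iff' _ 0 1 2 (by simp) (by simp),
    ShortComplex.moduleCat_exact_iff]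
  intro (x : Q.complex.X 1 ⟶ V) (hx : Q.complex.d 2 1 ≫ x = 0)
  have : Epi (Q.π.f 0) := inferInstance
  obtain ⟨y, hy⟩ := exists_comp_eq_of_kernel_hom_eq_zero (Q.exact_succ 0) Q.exact₀ p ‹_› hV x hx
  exact ⟨y, hy⟩

open MonoidAlgebra in
/-- The permutation module `k[G/B]` is projective if the order of `B` is invertible in `k`. -/
lemma projective_permutationModule (k : Type) [Field k] {G : Type} [Group G] [Finite G]
    (B : Subgroup G) (hB : (Nat.card B : k) ≠ 0) :
    Module.Projective (MonoidAlgebra k G) (permutationModule k B) := by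
  classical
  have := Fintype.ofFinite G
  let s₀ : permutationModule k B →ₗ[k] MonoidAlgebra k G :=
    (Nat.card B : k)⁻¹ • ∑ g : G, (coeffLinearEquiv k).symm.toLinearMap ∘ₗ Finsupp.lsingle g ∘ₗ
      Finsupp.lapply (g : G ⧸ B) ∘ₗ (coeffLinearEquiv k).toLinearMap ∘ₗ
      (Representation.ofMulAction k G (G ⧸ B)).asModuleEquiv.toLinearMap
  have hs₀ (f : permutationModule k B) : s₀ f = (Nat.card B : k)⁻¹ • ∑ g : G, single g
      (((Representation.ofMulAction k G (G ⧸ B)).asModuleEquiv f).coeff (g : G ⧸ B)) := by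
    simp [s₀]
  let s : permutationModule k B →ₗ[MonoidAlgebra k G] MonoidAlgebra k G :=
    equivariantOfLinearOfComm s₀ fun h f ↦ by
      rw [hs₀, hs₀, smul_eq_mul, mul_smul_comm, Finset.mul_sum]
      congr 1
      refine (Fintype.sum_equiv (Equiv.mulLeft h) _ _ fun g ↦ ?_).symm
      rw [single_mul_single, one_mul, Representation.single_smul, one_smul]
      congr 1
      exact (Finsupp.mapDomain_apply (MulAction.injective h) _ (g : G ⧸ B)).symm
  let t : MonoidAlgebra k G →ₗ[MonoidAlgebra k G] permutationModule k B :=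
    LinearMap.toSpanSingleton _ _
      ((Representation.ofMulAction k G (G ⧸ B)).asModuleEquiv.symm (single ((1 : G) : G ⧸ B) 1))
  refine Module.Projective.of_split s t (LinearMap.ext fun f ↦ ?_)
  have hfib (x : G ⧸ B) : (Finset.univ.filter fun g : G ↦ (g : G ⧸ B) = x).card = Nat.card B := by
    have := QuotientGroup.card_preimage_mk B {x}
    simpa [Nat.card_eq_fintype_card] using this
  obtain ⟨f, rfl⟩ := (Representation.ofMulAction k G (G ⧸ B)).asModuleEquiv.symm.surjective f
  change t (s₀ _) = _
  rw [hs₀]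
  apply (Representation.ofMulAction k G (G ⧸ B)).asModuleEquiv.injective
  simp only [t, LinearMap.toSpanSingleton_apply, Representation.asModuleEquiv_map_smul, map_smul,
    map_sum, LinearMap.smul_apply, LinearMap.sum_apply, Representation.asAlgebraHom_single,
    LinearEquiv.apply_symm_apply, Representation.ofMulAction_single, LinearMap.id_apply,
    MulAction.Quotient.smul_coe, smul_eq_mul, mul_one, smul_single]
  ext x
  have hterm (g : G) : (if (g : G ⧸ B) = x then f.coeff (g : G ⧸ B) else 0) =
      if (g : G ⧸ B) = x then f.coeff x else 0 := by
    split_ifs with h <;> simp [h]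
  simp [Finsupp.single_apply, hterm, ← Finset.sum_filter, hfib, hB,
    -Nat.card_eq_fintype_card]

/-- An upper-triangular matrix over a finite field `F` whose order divides a number prime
to `|F| (|F| - 1)` is trivial. -/
lemma eq_one_of_pow_eq_one_of_upperTriangular {n F : Type*} [Fintype n]
    [LinearOrder n] [Field F] [Fintype F] {r : ℕ}
    (hr : r.Coprime (Fintype.card F * (Fintype.card F - 1)))
    {M : Matrix n n F} (hM : M.IsUpperTriangular) (hMr : M ^ r = 1) : M = 1 := by
  obtain ⟨hq, hq'⟩ := Nat.coprime_mul_iff_right.1 hr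
  cases isEmpty_or_nonempty n
  · exact Subsingleton.elim _ _
  obtain ⟨p, _⟩ := CharP.exists F
  have : Fact p.Prime := ⟨CharP.char_is_prime F p⟩
  obtain ⟨m, -, hm⟩ := FiniteField.card F p
  have hdiag (i : n) : M i i = 1 := by
    have hspec : M i i ∈ spectrum F M := by
      rw [Matrix.mem_spectrum_iff_isRoot_charpoly, Matrix.charpoly_of_isUpperTriangular M hM]
      simpa [Polynomial.IsRoot, Polynomial.eval_prod, Finset.prod_eq_zero_iff, sub_eq_zero]
        using ⟨i, rfl⟩
    have hpow : M i i ^ r = 1 := by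
      have := spectrum.pow_mem_pow M r hspec
      rwa [hMr, spectrum.one_eq, Set.mem_singleton_iff] at this
    have hne : M i i ≠ 0 := by
      intro h
      rw [h, zero_pow_eq_one₀] at hpow
      rw [hpow, Nat.coprime_zero_left] at hq
      exact Fintype.one_lt_card.ne' hq
    have := pow_gcd_eq_one.2 ⟨hpow, FiniteField.pow_card_sub_one_eq_one _ hne⟩
    rwa [hq'.gcd_eq_one, pow_one] at this
  have hnil : (M - 1) ^ Fintype.card n = 0 := by
    have := M.aeval_self_charpoly
    rw [Matrix.charpoly_of_isUpperTriangular M hM] at this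
    simpa [hdiag] using this
  have hunip : M ^ p ^ Fintype.card n = 1 := by
    rw [← sub_eq_zero, ← one_pow (M := Matrix n n F) (p ^ Fintype.card n),
      ← sub_pow_char_pow_of_commute _ _ (Commute.one_right M)]
    exact pow_eq_zero_of_le (Nat.lt_pow_self (Fact.out : p.Prime).one_lt).le hnil
  have hrp : r.Coprime (p ^ Fintype.card n) :=
    .pow_right _ (hq.coprime_dvd_right (hm ▸ dvd_pow_self p m.ne_zero))
  have := pow_gcd_eq_one.2 ⟨hMr, hunip⟩
  rwa [hrp.gcd_eq_one, pow_one] at this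

/-- The order of the Borel subgroup of `GL n F` is prime to any prime not dividing
`|F| (|F| - 1)`. -/
lemma not_dvd_card_upperTriangularSubgroup (n : ℕ) (F : Type) [Field F] [Fintype F] {r : ℕ}
    (hr : r.Prime) (hrq : ¬ r ∣ Fintype.card F * (Fintype.card F - 1)) :
    ¬ r ∣ Nat.card (upperTriangularSubgroup n F) := by
  intro hdvd
  have : Fact r.Prime := ⟨hr⟩
  obtain ⟨b, hb⟩ := exists_prime_orderOf_dvd_card' r hdvd
  have hb1 : b = 1 := by
    have h := congrArg (fun g : upperTriangularSubgroup n F ↦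
      ((g : GL (Fin n) F) : Matrix (Fin n) (Fin n) F)) (pow_orderOf_eq_one b)
    rw [hb] at h
    have := eq_one_of_pow_eq_one_of_upperTriangular ((Nat.Prime.coprime_iff_not_dvd hr).2 hrq)
      (M := ((b : GL (Fin n) F) : Matrix (Fin n) (Fin n) F)) b.2 (by simpa using h)
    exact Subtype.ext (Units.ext this)
  rw [hb1, orderOf_one] at hb
  exact hr.one_lt.ne hb

/-- if `Y` is a simple `kG`-module lying in the head of `k[G/B]`
and `V` is a simple `kG`-module which is not a composition factor of `k[G/B]`
(no subquotient `N'/N` of `k[G/B]` is isomorphic to `V`), then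
`Ext¹_{kG}(Y, V) = 0`. -/
theorem ext_one_eq_zero_of_not_compositionFactor
    (n : ℕ) (hn : 0 < n) (q : ℕ) (hq : IsPrimePow q)
    (F : Type) [Field F] [Fintype F] (hF : Fintype.card F = q)
    (k : Type) [Field k] [IsAlgClosed k]
    (r : ℕ) (hr : ringChar k = r) (hr0 : 0 < r) (hrq : ¬ r ∣ q * (q - 1))
    (Y : Type) [AddCommGroup Y] [Module (MonoidAlgebra k (GL (Fin n) F)) Y]
    [IsSimpleModule (MonoidAlgebra k (GL (Fin n) F)) Y]
    (φ : permutationModule k (upperTriangularSubgroup n F)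
        →ₗ[MonoidAlgebra k (GL (Fin n) F)] Y)
    (hφ : Function.Surjective φ)
    (V : Type) [AddCommGroup V] [Module (MonoidAlgebra k (GL (Fin n) F)) V]
    [IsSimpleModule (MonoidAlgebra k (GL (Fin n) F)) V]
    (hV : ¬ ∃ (N N' : Submodule (MonoidAlgebra k (GL (Fin n) F))
            (permutationModule k (upperTriangularSubgroup n F))),
          N ≤ N' ∧
          -- `N'/N ≅ V`, phrased via a surjective linear map `N' → V` with kernel `N`
          ∃ ψ : ↥N' →ₗ[MonoidAlgebra k (GL (Fin n) F)] V,
            Function.Surjective ψ ∧ LinearMap.ker ψ = Submodule.comap N'.subtype N) :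
    Subsingleton
      (((Ext ℤ (ModuleCat (MonoidAlgebra k (GL (Fin n) F))) 1).obj
          (Opposite.op (ModuleCat.of (MonoidAlgebra k (GL (Fin n) F)) Y))).obj
        (ModuleCat.of (MonoidAlgebra k (GL (Fin n) F)) V)) := by
  subst hF
  have : CharP k r := hr ▸ ringChar.charP k
  have hrp : r.Prime := (CharP.char_is_prime_or_zero k r).resolve_right hr0.ne'
  have hB : (Nat.card (upperTriangularSubgroup n F) : k) ≠ 0 := by
    rw [Ne, CharP.cast_eq_zero_iff k r]
    exact not_dvd_card_upperTriangularSubgroup n F hrp hrq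
  have := projective_permutationModule k (upperTriangularSubgroup n F) hB
  have : Projective (ModuleCat.of (MonoidAlgebra k (GL (Fin n) F))
      (permutationModule k (upperTriangularSubgroup n F))) :=
    (IsProjective.iff_projective _).1 this
  have : Epi (ModuleCat.ofHom φ) := (ModuleCat.epi_iff_surjective _).2 hφ
  refine ModuleCat.subsingleton_of_isZero
    (isZero_ext_one_of_kernel_hom_eq_zero (ModuleCat.ofHom φ) fun f ↦ ?_)
  rw [← cancel_epi (ModuleCat.kernelIsoKer (ModuleCat.ofHom φ)).inv, Limits.comp_zero]
  by_contra hf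
  let ψ : LinearMap.ker φ →ₗ[MonoidAlgebra k (GL (Fin n) F)] V :=
    ((ModuleCat.kernelIsoKer (ModuleCat.ofHom φ)).inv ≫ f).hom
  have hψ : ψ ≠ 0 := fun h ↦ hf (ModuleCat.hom_ext h)
  refine hV ⟨(LinearMap.ker ψ).map (LinearMap.ker φ).subtype, LinearMap.ker φ,
    Submodule.map_subtype_le _ _, ψ, LinearMap.surjective_of_ne_zero hψ, ?_⟩
  rw [Submodule.comap_map_eq_of_injective (Submodule.subtype_injective _)]
end
end

section
/- Let l denote the multiplicative order of q modulo r, and assume l ≥ 3. Then the group cohomology of G = GL_n(q) with trivial coefficients vanishes in low degrees: H^i(G, k) = 0 for all i with 1 ≤ i ≤ l - 1. -/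
noncomputable section

open CategoryTheory Limits

universe u

/-- The permutation representation of `G` on the `k`-valued functions on a `G`-set `Y`. -/
def funRepresentation (k G Y : Type*) [CommRing k] [Group G] [MulAction G Y] :
    Representation k G (Y → k) where
  toFun g := LinearMap.funLeft k k (g⁻¹ • ·)
  map_one' := by ext; simp
  map_mul' g h := by ext; simp [LinearMap.funLeft_apply, mul_smul]

@[simp]
lemma funRepresentation_apply {k G Y : Type*} [CommRing k] [Group G] [MulAction G Y]
    (g : G) (f : Y → k) (y : Y) : funRepresentation k G Y g f y = f (g⁻¹ • y) := rfl

/-- The permutation representation of `G` on the `k`-valued functions on a `G`-set `Y`,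
as an object of `Rep k G`. -/
abbrev funRep (k G Y : Type u) [CommRing k] [Group G] [MulAction G Y] : Rep k G :=
  Rep.of (funRepresentation k G Y)

/-- The group cohomology of `A` vanishes in all degrees `1 ≤ i < N`. -/
def AcyclicBelow {k G : Type u} [CommRing k] [Group G] (A : Rep k G) (N : ℕ) : Prop :=
  ∀ i, 1 ≤ i → i < N → IsZero (groupCohomology A i)

section Acyclic

variable {k G : Type u} [CommRing k] [Group G] {N : ℕ}

instance (n : ℕ) : (groupCohomology.functor k G n).Additive :=
  inferInstanceAs (groupCohomology.cochainsFunctor k G ⋙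
    HomologicalComplex.homologyFunctor (ModuleCat k) (.up ℕ) n).Additive

/-- If the identity of `A` is a finite sum of endomorphisms factoring through representations
which are acyclic in a range, then so is `A`. -/
lemma AcyclicBelow.of_sum_eq_id {A : Rep k G} {ι : Type*} (s : Finset ι) (B : ι → Rep k G)
    (f : ∀ i, A ⟶ B i) (g : ∀ i, B i ⟶ A) (h : ∑ i ∈ s, f i ≫ g i = 𝟙 A)
    (hB : ∀ i, AcyclicBelow (B i) N) : AcyclicBelow A N := by
  intro n hn hnN
  rw [IsZero.iff_id_eq_zero]
  have := congrArg (groupCohomology.functor k G n).map h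
  rw [Functor.map_sum, CategoryTheory.Functor.map_id] at this
  refine this.symm.trans (Finset.sum_eq_zero fun i _ ↦ ?_)
  rw [Functor.map_comp]
  exact (hB i n hn hnN).eq_zero_of_tgt ((groupCohomology.functor k G n).map (f i)) ▸ zero_comp

lemma AcyclicBelow.of_retract {A B : Rep k G} (f : A ⟶ B) (g : B ⟶ A) (h : f ≫ g = 𝟙 A)
    (hB : AcyclicBelow B N) : AcyclicBelow A N :=
  .of_sum_eq_id (Finset.univ : Finset Unit) (fun _ ↦ B) (fun _ ↦ f) (fun _ ↦ g) (by simpa)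
    fun _ ↦ hB

lemma AcyclicBelow.coind {S : Subgroup G} {A : Rep k S} (h : AcyclicBelow A N) :
    AcyclicBelow (Rep.coind S.subtype A) N :=
  fun n hn hnN ↦ (h n hn hnN).of_iso (groupCohomology.coindIso A n)

/-- Acyclicity in a range of the trivial representation passes to retracts of groups. -/
lemma AcyclicBelow.trivial_of_retract {H : Type u} [Group H] (a : G →* H) (b : H →* G)
    (hab : b.comp a = .id G) (h : AcyclicBelow (Rep.trivial k H k) N) :
    AcyclicBelow (Rep.trivial k G k) N := by
  intro n hn hnN
  rw [IsZero.iff_id_eq_zero]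
  let φ : Rep.res b (Rep.trivial k G k) ⟶ Rep.trivial k H k := Rep.ofHom ⟨.id, fun _ ↦ rfl⟩
  let ψ : Rep.res a (Rep.trivial k H k) ⟶ Rep.trivial k G k := Rep.ofHom ⟨.id, fun _ ↦ rfl⟩
  have h₁ := groupCohomology.map_comp b a φ ψ n
  rw [(h n hn hnN).eq_zero_of_tgt (groupCohomology.map b φ n), zero_comp] at h₁
  rw [← groupCohomology.map_id, ← h₁]
  exact groupCohomology.map_congr hab.symm rfl n

/-- If the cohomology of `A` and of `B` vanishes in a range and `0 ⟶ K ⟶ A ⟶ B ⟶ 0` is exact and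
stays exact on invariants, the cohomology of `K` vanishes in a shifted range. -/
lemma AcyclicBelow.of_shortExact {X : ShortComplex (Rep k G)} (hX : X.ShortExact)
    (h₂ : AcyclicBelow X.X₂ (N + 1)) (h₃ : AcyclicBelow X.X₃ N)
    (hinv : ∀ z : X.X₃, (∀ g, X.X₃.ρ g z = z) →
      ∃ y : X.X₂, (∀ g, X.X₂.ρ g y = y) ∧ X.g.hom y = z) : AcyclicBelow X.X₁ (N + 1) := by
  intro j hj hjN
  obtain ⟨i, rfl⟩ : ∃ i, j = i + 1 := ⟨j - 1, by omega⟩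
  refine (groupCohomology.mapShortComplex₁_exact hX rfl).isZero_of_both_zeros ?_
    ((h₂ _ hj hjN).eq_zero_of_tgt _)
  rcases Nat.eq_zero_or_pos i with rfl | hi
  · have : Epi (groupCohomology.map (MonoidHom.id G) X.g 0) := by
      rw [ModuleCat.epi_iff_surjective]
      intro z
      obtain ⟨z, rfl⟩ := (groupCohomology.H0Iso X.X₃).toLinearEquiv.symm.surjective z
      obtain ⟨y, hy, hyz⟩ := hinv z.1 z.2
      refine ⟨(groupCohomology.H0Iso X.X₂).inv ⟨y, hy⟩, ?_⟩
      apply (groupCohomology.H0Iso X.X₃).toLinearEquiv.injective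
      rw [LinearEquiv.apply_symm_apply]
      apply Subtype.ext
      have := groupCohomology.map_id_comp_H0Iso_hom_apply X.g
        ((groupCohomology.H0Iso X.X₂).inv ⟨y, hy⟩)
      rw [Iso.inv_hom_id_apply] at this
      exact (congrArg Subtype.val this).trans hyz
    exact zero_of_epi_comp (groupCohomology.map (MonoidHom.id G) X.g 0)
      ((groupCohomology.map_cochainsFunctor_shortExact hX).comp_δ 0 1 rfl)
  · exact (h₃ i hi (by omega)).eq_zero_of_src _

end Acyclic

section FunRep

variable {k G : Type u} [CommRing k] [Group G] {N : ℕ} {Y : Type u} [MulAction G Y]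

/-- A `G`-equivariant linear map between representations, as a morphism in `Rep k G`. -/
abbrev Rep.homMk {A B : Rep k G} (f : A.V →ₗ[k] B.V) (hf : ∀ g x, f (A.ρ g x) = B.ρ g (f x)) :
    A ⟶ B :=
  Rep.ofHom (LinearMap.intertwiningMap_of_isIntertwiningMap A.ρ B.ρ f hf)

lemma Rep.hom_ext_apply {A B : Rep k G} {f g : A ⟶ B} (h : ∀ x : A.V, f.hom x = g.hom x) : f = g :=
  Rep.hom_ext (DFunLike.ext _ _ h)

lemma Rep.sum_hom_apply {A B : Rep k G} {ι : Type*} (s : Finset ι) (f : ι → (A ⟶ B)) (x : A.V) :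
    (∑ i ∈ s, f i).hom x = ∑ i ∈ s, (f i).hom x :=
  map_sum (AddMonoidHom.mk' (fun φ : A ⟶ B ↦ φ.hom x) fun _ _ ↦ rfl) f s

variable (k) in
/-- Restriction of functions to the orbit of `y`, viewed as a coinduced representation. -/
def funRepToCoind (y : Y) : funRep k G Y ⟶
    Rep.coind (MulAction.stabilizer G y).subtype (Rep.trivial k _ k) :=
  Rep.homMk
    { toFun f := ⟨fun g ↦ f (g⁻¹ • y), fun s h ↦ by
        have : (s : G)⁻¹ • y = y := (s⁻¹).2
        simp [mul_smul, this]⟩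
      map_add' _ _ := rfl
      map_smul' _ _ := rfl }
    fun g f ↦ Subtype.ext <| funext fun h ↦ by
      change f (g⁻¹ • h⁻¹ • y) = f ((h * g)⁻¹ • y)
      rw [mul_inv_rev, mul_smul]

lemma apply_eq_of_mem_coindV {y : Y} {φ : G → k}
    (hφ : φ ∈ Representation.coindV (MulAction.stabilizer G y).subtype
      (Representation.trivial k (MulAction.stabilizer G y) k)) {g h : G} (hgh : g • y = h • y) :
    φ g⁻¹ = φ h⁻¹ := by
  have := hφ ⟨g⁻¹ * h, by simp [MulAction.mem_stabilizer_iff, mul_smul, ← hgh]⟩ h⁻¹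
  simpa using this

open Classical in
variable (k) in
/-- Extension by zero of functions on the orbit of `y`, viewed as a coinduced representation. -/
def coindToFunRep (y : Y) :
    Rep.coind (MulAction.stabilizer G y).subtype (Rep.trivial k _ k) ⟶ funRep k G Y :=
  Rep.homMk
    { toFun φ z := if h : ∃ g : G, g • y = z then φ.1 h.choose⁻¹ else 0
      map_add' _ _ := by ext z; by_cases h : ∃ g : G, g • y = z <;> simp [h]
      map_smul' _ _ := by ext z; by_cases h : ∃ g : G, g • y = z <;> simp [h] }
    fun g φ ↦ funext fun z ↦ by
      by_cases h : ∃ x : G, x • y = z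
      · have h' : ∃ x : G, x • y = g⁻¹ • z := ⟨g⁻¹ * h.choose, by rw [mul_smul, h.choose_spec]⟩
        have e : (g⁻¹ * h.choose) • y = h'.choose • y := by
          rw [mul_smul, h.choose_spec, h'.choose_spec]
        have := apply_eq_of_mem_coindV φ.2 e
        simp only [LinearMap.coe_mk, AddHom.coe_mk, funRepresentation_apply, dif_pos h, dif_pos h',
          ← this]
        change φ.1 (h.choose⁻¹ * g) = _
        simp
      · have h' : ¬ ∃ x : G, x • y = g⁻¹ • z :=
          fun ⟨x, hx⟩ ↦ h ⟨g * x, by rw [mul_smul, hx, smul_inv_smul]⟩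
        simp only [LinearMap.coe_mk, AddHom.coe_mk, funRepresentation_apply, dif_neg h, dif_neg h']

open Classical in
lemma coindToFunRep_funRepToCoind_apply (y : Y) (f : Y → k) (z : Y) :
    (funRepToCoind k (G := G) y ≫ coindToFunRep k y).hom f z =
      if z ∈ MulAction.orbit G y then f z else 0 := by
  change (if h : ∃ g : G, g • y = z then f (h.choose⁻¹⁻¹ • y) else 0) = _
  split_ifs with h h' h'
  · rw [inv_inv, h.choose_spec]
  · exact (h' h).elim
  · exact (h h').elim
  · rfl

/-- The functions on a finite `G`-set are acyclic in a range as soon as the trivial representation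
of every stabilizer is. -/
lemma AcyclicBelow.funRep_of_stabilizer [Finite Y]
    (h : ∀ y : Y, AcyclicBelow (Rep.trivial k (MulAction.stabilizer G y) k) N) :
    AcyclicBelow (funRep k G Y) N := by
  classical
  have := Fintype.ofFinite (MulAction.orbitRel.Quotient G Y)
  refine .of_sum_eq_id (Finset.univ : Finset (MulAction.orbitRel.Quotient G Y)) _
    (fun o ↦ funRepToCoind k o.out) (fun o ↦ coindToFunRep k o.out) ?_ fun o ↦ (h o.out).coind
  refine Rep.hom_ext_apply fun f ↦ funext fun z ↦ ?_
  have : (∑ o : MulAction.orbitRel.Quotient G Y,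
      (funRepToCoind k (G := G) o.out ≫ coindToFunRep k o.out).hom f) z = f z := by
    rw [Finset.sum_apply, Finset.sum_eq_single (Quotient.mk (MulAction.orbitRel G Y) z)]
    · rw [coindToFunRep_funRepToCoind_apply, if_pos]
      exact (MulAction.orbitRel_apply (G := G)).1
        (Setoid.symm' _ (@Quotient.mk_out _ (MulAction.orbitRel G Y) z))
    · intro o _ ho
      rw [coindToFunRep_funRepToCoind_apply, if_neg]
      intro hz
      apply ho
      rw [← o.out_eq]
      exact (@Quotient.sound _ (MulAction.orbitRel G Y) _ _ hz).symm
    · simp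
  rw [Rep.sum_hom_apply]
  exact this

/-- An equivariant map of finite `G`-sets whose fibres have invertible cardinality exhibits the
functions on the target as a retract of the functions on the source. -/
lemma AcyclicBelow.funRep_of_fibers {k : Type u} [Field k] {Z : Type u} [MulAction G Z] [Finite Z]
    (π : Z → Y) (hπ : ∀ (g : G) z, π (g • z) = g • π z)
    (hfib : ∀ y, (Nat.card {z // π z = y} : k) ≠ 0) (h : AcyclicBelow (funRep k G Z) N) :
    AcyclicBelow (funRep k G Y) N := by
  classical
  have := Fintype.ofFinite Z
  refine h.of_retract (Rep.homMk (LinearMap.funLeft k k π) ?_) (Rep.homMk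
    { toFun (f : Z → k) y := (Nat.card {z // π z = y} : k)⁻¹ * ∑ z : {z // π z = y}, f z
      map_add' _ _ := funext fun _ ↦ by simp [Finset.sum_add_distrib, mul_add]
      map_smul' _ _ := funext fun _ ↦ by simp [Finset.mul_sum, mul_left_comm] } ?_) ?_
  · intro g f
    ext z
    simp [LinearMap.funLeft_apply, hπ]
  · intro g f
    funext y
    let e : {z // π z = y} ≃ {z // π z = g⁻¹ • y} :=
      (MulAction.toPerm g⁻¹).subtypeEquiv fun z ↦ by simp [hπ]
    simp only [LinearMap.coe_mk, AddHom.coe_mk, funRepresentation_apply, Nat.card_congr e]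
    congr 1
    exact Fintype.sum_equiv e _ _ fun z ↦ rfl
  · refine Rep.hom_ext_apply fun (f : Y → k) ↦ funext fun y ↦ ?_
    change (Nat.card {z // π z = y} : k)⁻¹ * ∑ z : {z // π z = y}, f (π z) = f y
    rw [Finset.sum_congr rfl fun z _ ↦ congrArg f z.2]
    simp only [Finset.sum_const, Finset.card_univ, ← Nat.card_eq_fintype_card, nsmul_eq_mul]
    rw [inv_mul_cancel_left₀ (hfib y)]

end FunRep

section Coboundary

variable (k : Type*) [CommRing k] (X : Type*)

/-- The coboundary of the (augmented) cochain complex of `k`-valued functions on tuples of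
elements of `X`. -/
def tupleCoboundary (m : ℕ) : ((Fin m → X) → k) →ₗ[k] ((Fin (m + 1) → X) → k) where
  toFun f v := ∑ j : Fin (m + 1), (-1) ^ (j : ℕ) * f (j.removeNth v)
  map_add' _ _ := by ext; simp [mul_add, Finset.sum_add_distrib]
  map_smul' _ _ := by ext; simp [Finset.mul_sum, mul_left_comm]

variable {k X}

lemma tupleCoboundary_apply {m : ℕ} (f : (Fin m → X) → k) (v : Fin (m + 1) → X) :
    tupleCoboundary k X m f v = ∑ j : Fin (m + 1), (-1) ^ (j : ℕ) * f (j.removeNth v) := rfl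

lemma tupleCoboundary_cons {m : ℕ} (f : (Fin (m + 1) → X) → k) (x : X) (v : Fin (m + 1) → X) :
    tupleCoboundary k X (m + 1) f (Fin.cons x v : Fin (m + 2) → X) =
      f v - tupleCoboundary k X m (fun w ↦ f (Fin.cons x w : Fin (m + 1) → X)) v := by
  rw [tupleCoboundary_apply, Fin.sum_univ_succ, tupleCoboundary_apply, sub_eq_add_neg,
    ← Finset.sum_neg_distrib]
  congr 1
  · simp
  · refine Finset.sum_congr rfl fun j _ ↦ ?_
    have : j.succ.removeNth (Fin.cons x v : Fin (m + 2) → X) =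
        (Fin.cons x (j.removeNth v) : Fin (m + 1) → X) := by
      ext i
      refine Fin.cases ?_ (fun i ↦ ?_) i <;> simp [Fin.removeNth]
    rw [this, Fin.val_succ, pow_succ]
    ring

lemma tupleCoboundary_tupleCoboundary {m : ℕ} (f : (Fin m → X) → k) :
    tupleCoboundary k X (m + 1) (tupleCoboundary k X m f) = 0 := by
  funext v
  induction m with
  | zero =>
    have h (w : Fin 0 → X) : f w = f Fin.elim0 := congrArg f (Subsingleton.elim _ _)
    simp [tupleCoboundary_apply, Fin.sum_univ_two, h]
  | succ m ih =>
    obtain ⟨x, v, rfl⟩ : ∃ x w, v = (Fin.cons x w : Fin (m + 3) → X) :=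
      ⟨v 0, Fin.tail v, (Fin.cons_self_tail v).symm⟩
    rw [tupleCoboundary_cons]
    simp only [tupleCoboundary_cons f x]
    rw [show (fun w ↦ f w - tupleCoboundary k X m
      (fun w ↦ f (Fin.cons x w : Fin (m + 1) → X)) w) = f - tupleCoboundary k X m
      (fun w ↦ f (Fin.cons x w : Fin (m + 1) → X)) from rfl, map_sub, Pi.sub_apply, ih]
    simp

lemma exists_tupleCoboundary_eq [Nonempty X] {m : ℕ} {f : (Fin (m + 1) → X) → k}
    (hf : tupleCoboundary k X (m + 1) f = 0) : ∃ f', tupleCoboundary k X m f' = f := by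
  obtain ⟨x⟩ := ‹Nonempty X›
  refine ⟨fun w ↦ f (Fin.cons x w : Fin (m + 1) → X), funext fun v ↦ ?_⟩
  have := tupleCoboundary_cons f x v
  rw [hf] at this
  exact (sub_eq_zero.1 this.symm).symm

lemma tupleCoboundary_smul {G : Type*} [Group G] [MulAction G X] {m : ℕ} (g : G)
    (f : (Fin m → X) → k) :
    tupleCoboundary k X m (funRepresentation k G _ g f) =
      funRepresentation k G _ g (tupleCoboundary k X m f) := rfl

end Coboundary

section TupleRep

variable (k G X : Type u) [CommRing k] [Group G] [MulAction G X]

/-- The representation of `G` on the cocycles of the complex of functions on tuples. -/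
abbrev tupleCocycles (m : ℕ) : Rep k G :=
  Rep.subrepresentation (funRep k G (Fin m → X)) (LinearMap.ker (tupleCoboundary k X m))
    fun g f hf ↦ by
      change tupleCoboundary k X m (funRepresentation k G _ g f) = 0
      rw [tupleCoboundary_smul, LinearMap.mem_ker.1 hf, map_zero]

/-- The sequence of cocycles, cochains and coboundaries for functions on tuples. -/
def tupleShortComplex (m : ℕ) : ShortComplex (Rep k G) where
  X₁ := tupleCocycles k G X m
  X₂ := funRep k G (Fin m → X)
  X₃ := tupleCocycles k G X (m + 1)
  f := Rep.subtype _ _ _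
  g := Rep.homMk ((tupleCoboundary k X m).codRestrict _ tupleCoboundary_tupleCoboundary)
    fun g f ↦ Subtype.ext (tupleCoboundary_smul g f)
  zero := Rep.hom_ext_apply fun x ↦ Subtype.ext x.2

lemma tupleShortComplex_shortExact [Nonempty X] (m : ℕ) :
    (tupleShortComplex k G X m).ShortExact where
  exact := by
    rw [← ShortComplex.exact_map_iff_of_faithful _ (forget₂ (Rep k G) (ModuleCat k)),
      ShortComplex.moduleCat_exact_iff]
    intro x hx
    exact ⟨⟨x, congrArg Subtype.val hx⟩, rfl⟩
  mono_f := (Rep.mono_iff_injective _).2 Subtype.val_injective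
  epi_g := (Rep.epi_iff_surjective _).2 fun z ↦
    (exists_tupleCoboundary_eq z.2).imp fun _ h ↦ Subtype.ext h

variable {k G X} {N : ℕ}

lemma acyclicBelow_tupleCocycles [Nonempty X]
    (hC : ∀ m, 1 ≤ m → AcyclicBelow (funRep k G (Fin m → X)) N)
    (hinv : ∀ m, 1 ≤ m → m + 1 ≤ N → ∀ f : (Fin (m + 1) → X) → k,
      (∀ g, funRepresentation k G _ g f = f) → tupleCoboundary k X (m + 1) f = 0 →
      ∃ f', (∀ g, funRepresentation k G _ g f' = f') ∧ tupleCoboundary k X m f' = f)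
    (M m : ℕ) (hm : 1 ≤ m) (hM : M + m ≤ N + 1) :
    AcyclicBelow (tupleCocycles k G X m) M := by
  induction M generalizing m with
  | zero => exact fun i _ hi ↦ absurd hi (by omega)
  | succ M ih =>
    rcases Nat.eq_zero_or_pos M with rfl | hMpos
    · exact fun i _ hi ↦ absurd hi (by omega)
    refine AcyclicBelow.of_shortExact (tupleShortComplex_shortExact k G X m)
      (fun i hi hiM ↦ hC m hm i hi (by omega)) (ih (m + 1) (by omega) (by omega)) fun z hz ↦ ?_
    obtain ⟨y, hy, hyz⟩ := hinv m hm (by omega) z.1 (fun g ↦ congrArg Subtype.val (hz g)) z.2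
    exact ⟨y, hy, Subtype.ext hyz⟩

/-- If functions on nonempty tuples of elements of `X` are acyclic in a range and the complex of
invariant functions is exact in a range, then the trivial representation is acyclic. -/
lemma AcyclicBelow.trivial_of_tuples [Nonempty X]
    (hC : ∀ m, 1 ≤ m → AcyclicBelow (funRep k G (Fin m → X)) N)
    (hinv : ∀ m, 1 ≤ m → m + 1 ≤ N → ∀ f : (Fin (m + 1) → X) → k,
      (∀ g, funRepresentation k G _ g f = f) → tupleCoboundary k X (m + 1) f = 0 →
      ∃ f', (∀ g, funRepresentation k G _ g f' = f') ∧ tupleCoboundary k X m f' = f) :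
    AcyclicBelow (Rep.trivial k G k) N := by
  obtain ⟨x⟩ := ‹Nonempty X›
  have : Nonempty X := ⟨x⟩
  let c : LinearMap.ker (tupleCoboundary k X 1) := ⟨fun _ ↦ 1, by
    rw [LinearMap.mem_ker]
    funext v
    simp [tupleCoboundary_apply, Fin.sum_univ_two]⟩
  let p : LinearMap.ker (tupleCoboundary k X 1) →ₗ[k] k :=
    LinearMap.proj (R := k) (φ := fun _ : Fin 1 → X ↦ k) (fun _ ↦ x) ∘ₗ Submodule.subtype _
  refine (acyclicBelow_tupleCocycles hC hinv N 1 le_rfl le_rfl).of_retract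
    (Rep.homMk (A := Rep.trivial k G k) (LinearMap.toSpanSingleton k _ c)
      fun g c ↦ Subtype.ext (funext fun v ↦ rfl))
    (Rep.homMk (B := Rep.trivial k G k) p ?_) ?_
  · rintro g ⟨f, hf⟩
    have := congrFun (LinearMap.mem_ker.1 hf) ![x, g⁻¹ • x]
    simp [tupleCoboundary_apply] at this
    change f (g⁻¹ • fun _ ↦ x) = f fun _ ↦ x
    convert add_neg_eq_zero.1 this using 2 <;> ext i <;> simp [Fin.removeNth, Subsingleton.elim i 0]
  · refine Rep.hom_ext_apply fun c ↦ ?_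
    change c * 1 = c
    simp

end TupleRep

section LinearAlgebra

variable {F V : Type*} [Field F] [AddCommGroup V] [Module F V]

/-- Linear automorphisms fixing a subspace pointwise act transitively on its complement. -/
lemma exists_linearEquiv_fixing_of_notMem [FiniteDimensional F V] {W : Submodule F V} {w w' : V}
    (hw : w ∉ W) (hw' : w' ∉ W) : ∃ g : V ≃ₗ[F] V, (∀ x ∈ W, g x = x) ∧ g w = w' := by
  obtain ⟨φ, hφ, hφw, hφw'⟩ : ∃ φ : V →ₗ[F] F, W ≤ LinearMap.ker φ ∧ φ w ≠ 0 ∧ φ w' ≠ 0 := by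
    obtain ⟨φ, h, hφ⟩ := W.exists_le_ker_of_notMem hw
    obtain ⟨ψ, h', hψ⟩ := W.exists_le_ker_of_notMem hw'
    by_cases h₁ : φ w' = 0
    · by_cases h₂ : ψ w = 0
      · refine ⟨φ + ψ, fun x hx ↦ ?_, by simpa [h₂], by simpa [h₁]⟩
        simp [LinearMap.mem_ker.1 (hφ hx), LinearMap.mem_ker.1 (hψ hx)]
      · exact ⟨ψ, hψ, h₂, h'⟩
    · exact ⟨φ, hφ, h, h₁⟩
  let g : V →ₗ[F] V := LinearMap.id + φ.smulRight ((φ w)⁻¹ • (w' - w))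
  have hg (x : V) : g x = x + φ x • (φ w)⁻¹ • (w' - w) := rfl
  have hinj : Function.Injective g := by
    refine (injective_iff_map_eq_zero g).2 fun x hx ↦ ?_
    have h : φ (g x) = φ x * ((φ w)⁻¹ * φ w') := by
      simp only [hg, map_add, map_smul, map_sub, smul_eq_mul]
      field_simp
      ring
    have h₀ : φ x = 0 := by simpa [hx, hφw, hφw'] using h
    simpa [hg, h₀] using hx
  refine ⟨LinearEquiv.ofInjectiveEndo g hinj, fun x hx ↦ ?_, ?_⟩
  · simp [hg, LinearMap.mem_ker.1 (hφ hx)]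
  · simp [hg, hφw]

/-- The action of the general linear group on nonzero vectors. -/
instance : MulAction (V ≃ₗ[F] V) {v : V // v ≠ 0} where
  smul g v := ⟨g v, by simpa using v.2⟩
  one_smul _ := rfl
  mul_smul _ _ _ := rfl

@[simp]
lemma coe_linearEquiv_smul (g : V ≃ₗ[F] V) (v : {v : V // v ≠ 0}) :
    ((g • v : {v : V // v ≠ 0}) : V) = g v := rfl

variable (F) in
/-- The span of a tuple of nonzero vectors. -/
def tupleSpan {m : ℕ} (v : Fin m → {v : V // v ≠ 0}) : Submodule F V :=
  .span F (Set.range fun i ↦ (v i : V))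

lemma mem_tupleSpan {m : ℕ} (v : Fin m → {v : V // v ≠ 0}) (i : Fin m) :
    (v i : V) ∈ tupleSpan F v :=
  Submodule.subset_span ⟨i, rfl⟩

lemma tupleSpan_le {m : ℕ} {v : Fin m → {v : V // v ≠ 0}} {W : Submodule F V} :
    tupleSpan F v ≤ W ↔ ∀ i, (v i : V) ∈ W := by
  simp [tupleSpan, Submodule.span_le, Set.range_subset_iff]

lemma tupleSpan_smul {m : ℕ} (g : V ≃ₗ[F] V) (v : Fin m → {v : V // v ≠ 0}) :
    tupleSpan F (g • v) = (tupleSpan F v).map (g : V →ₗ[F] V) := by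
  rw [tupleSpan, tupleSpan, Submodule.map_span, ← Set.range_comp]
  rfl

lemma tupleSpan_removeNth_le {m : ℕ} (v : Fin (m + 1) → {v : V // v ≠ 0}) (j : Fin (m + 1)) :
    tupleSpan F (j.removeNth v) ≤ tupleSpan F v :=
  tupleSpan_le.2 fun _ ↦ mem_tupleSpan v _

lemma tupleSpan_ne_top {m : ℕ} (hm : m < Module.finrank F V) (v : Fin m → {v : V // v ≠ 0}) :
    tupleSpan F v ≠ ⊤ := by
  intro h
  have := finrank_range_le_card (R := F) fun i ↦ (v i : V)
  rw [Set.finrank, ← tupleSpan, h, finrank_top, Fintype.card_fin] at this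
  omega

lemma smul_eq_self_of_mem_tupleSpan {m : ℕ} {g : V ≃ₗ[F] V} {v : Fin m → {v : V // v ≠ 0}}
    (hg : g • v = v) {x : V} (hx : x ∈ tupleSpan F v) : g x = x := by
  have : tupleSpan F v ≤ LinearMap.eqLocus (g : V →ₗ[F] V) LinearMap.id :=
    tupleSpan_le.2 fun i ↦ congrArg Subtype.val (congrFun hg i)
  exact this hx

lemma exists_smul_eq_of_tupleSpan_eq_top {m : ℕ} (hm : m = Module.finrank F V)
    {v u : Fin m → {v : V // v ≠ 0}} (hv : tupleSpan F v = ⊤) (hu : tupleSpan F u = ⊤) :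
    ∃ g : V ≃ₗ[F] V, g • v = u := by
  let b := basisOfTopLeSpanOfCardEqFinrank (fun i ↦ (v i : V)) hv.ge (by simpa)
  let c := basisOfTopLeSpanOfCardEqFinrank (fun i ↦ (u i : V)) hu.ge (by simpa)
  refine ⟨b.equiv c (.refl _), funext fun i ↦ Subtype.ext ?_⟩
  have hb : b i = v i := congrFun (coe_basisOfTopLeSpanOfCardEqFinrank _ _ _) i
  have hc : c i = u i := congrFun (coe_basisOfTopLeSpanOfCardEqFinrank _ _ _) i
  change b.equiv c (.refl _) (v i) = u i
  rw [← hb, b.equiv_apply, Equiv.refl_apply, hc]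

variable {k : Type*} [Field k]

lemma funRepresentation_eq_self_iff {G Y : Type*} [Group G] [MulAction G Y] {f : Y → k} :
    (∀ g, funRepresentation k G Y g f = f) ↔ ∀ (g : G) y, f (g • y) = f y :=
  ⟨fun h g y ↦ by simpa using congrFun (h g⁻¹) y, fun h g ↦ funext fun y ↦ h g⁻¹ y⟩

lemma smul_cons {m : ℕ} {G Y : Type*} [Group G] [MulAction G Y] (g : G) (x : Y) (v : Fin m → Y) :
    g • (Fin.cons x v : Fin (m + 1) → Y) = Fin.cons (g • x) (g • v) := by
  ext i
  refine Fin.cases ?_ (fun i ↦ ?_) i <;> simp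

/-- An invariant cocycle on tuples of nonzero vectors which vanishes on nonspanning tuples
vanishes. -/
lemma eq_zero_of_tupleCoboundary_eq_zero (h2 : (2 : k) ≠ 0) {m : ℕ} (hm : 1 ≤ m)
    (hmd : m + 1 ≤ Module.finrank F V) {f : (Fin (m + 1) → {v : V // v ≠ 0}) → k}
    (hf : ∀ (g : V ≃ₗ[F] V) v, f (g • v) = f v)
    (hdf : tupleCoboundary k {v : V // v ≠ 0} (m + 1) f = 0)
    (h₀ : ∀ v, tupleSpan F v ≠ ⊤ → f v = 0) : f = 0 := by
  funext v
  by_cases hv : tupleSpan F v ≠ ⊤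
  · exact h₀ v hv
  rw [not_not] at hv
  obtain ⟨m, rfl⟩ : ∃ a, m = a + 1 := ⟨m - 1, by omega⟩
  have key := tupleCoboundary_cons f (v 1) v
  rw [hdf, Pi.zero_apply, tupleCoboundary_apply, Finset.sum_eq_single 1] at key
  · set u : Fin (m + 2) → {v : V // v ≠ 0} := Fin.cons (v 1) (Fin.removeNth 1 v)
    by_cases hu : tupleSpan F u = ⊤
    · have hd : m + 2 = Module.finrank F V := le_antisymm hmd <| not_lt.1 fun h ↦
        tupleSpan_ne_top h v hv
      obtain ⟨g, hg⟩ := exists_smul_eq_of_tupleSpan_eq_top hd hv hu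
      rw [← hg, hf, Fin.val_one, pow_one, neg_one_mul, sub_neg_eq_add, ← two_mul] at key
      exact (mul_eq_zero.1 key.symm).resolve_left h2
    · simpa [h₀ u hu] using key.symm
  · intro j _ hj
    rw [h₀, mul_zero]
    obtain ⟨i, hi⟩ := Fin.exists_succAbove_eq hj.symm
    refine ne_top_of_le_ne_top (tupleSpan_ne_top hmd (j.removeNth v)) (tupleSpan_le.2 fun a ↦ ?_)
    refine Fin.cases ?_ (fun a ↦ mem_tupleSpan _ a) a
    exact hi ▸ mem_tupleSpan (F := F) (j.removeNth v) i
  · simp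

/-- The complex of invariant functions on tuples of nonzero vectors is exact up to the dimension
of the space. -/
lemma exists_invariant_tupleCoboundary_eq [FiniteDimensional F V] (h2 : (2 : k) ≠ 0) {m : ℕ}
    (hm : 1 ≤ m) (hmd : m + 1 ≤ Module.finrank F V) {f : (Fin (m + 1) → {v : V // v ≠ 0}) → k}
    (hf : ∀ g, funRepresentation k (V ≃ₗ[F] V) _ g f = f)
    (hdf : tupleCoboundary k {v : V // v ≠ 0} (m + 1) f = 0) :
    ∃ f', (∀ g, funRepresentation k (V ≃ₗ[F] V) _ g f' = f') ∧
      tupleCoboundary k {v : V // v ≠ 0} m f' = f := by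
  rw [funRepresentation_eq_self_iff] at hf
  have hex {a : ℕ} (v : Fin a → {v : V // v ≠ 0}) (hv : tupleSpan F v ≠ ⊤) :
      ∃ x : {v : V // v ≠ 0}, (x : V) ∉ tupleSpan F v := by
    obtain ⟨x, hx⟩ := SetLike.exists_not_mem_of_ne_top _ hv rfl
    exact ⟨⟨x, fun h ↦ hx (h ▸ zero_mem _)⟩, hx⟩
  choose w hw using fun v : Fin m → {v : V // v ≠ 0} ↦ hex v (tupleSpan_ne_top hmd v)
  let f' (v : Fin m → {v : V // v ≠ 0}) : k := f (Fin.cons (w v) v : Fin (m + 1) → _)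
  have hf' (v : Fin m → {v : V // v ≠ 0}) (x : {v : V // v ≠ 0}) (hx : (x : V) ∉ tupleSpan F v) :
      f (Fin.cons x v : Fin (m + 1) → _) = f' v := by
    obtain ⟨g, hg, hgw⟩ := exists_linearEquiv_fixing_of_notMem (hw v) hx
    have hv : g • v = v := funext fun i ↦ Subtype.ext (hg _ (mem_tupleSpan v i))
    have hx : g • w v = x := Subtype.ext hgw
    change _ = f (Fin.cons (w v) v)
    rw [← hx, ← hf g (Fin.cons (w v) v), smul_cons, hv]
  have hinv (g : V ≃ₗ[F] V) (v) : f' (g • v) = f' v := by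
    rw [← hf' (g • v) (g • w v), ← smul_cons, hf]
    rw [tupleSpan_smul]
    simpa using hw v
  have hns (v : Fin (m + 1) → {v : V // v ≠ 0}) (hv : tupleSpan F v ≠ ⊤) :
      tupleCoboundary k {v : V // v ≠ 0} m f' v = f v := by
    obtain ⟨x, hx⟩ := hex v hv
    have := tupleCoboundary_cons f x v
    rw [hdf, Pi.zero_apply, eq_comm, sub_eq_zero] at this
    rw [this, tupleCoboundary_apply, tupleCoboundary_apply]
    refine Finset.sum_congr rfl fun j _ ↦ ?_
    rw [hf' _ x fun h ↦ hx (tupleSpan_removeNth_le v j h)]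
  refine ⟨f', funRepresentation_eq_self_iff.2 hinv, (sub_eq_zero.1 ?_).symm⟩
  refine eq_zero_of_tupleCoboundary_eq_zero (F := F) h2 hm hmd (fun g v ↦ ?_) ?_ fun v hv ↦ ?_
  · have : tupleCoboundary k {v : V // v ≠ 0} m f' (g • v) =
        tupleCoboundary k _ m f' v := by
      rw [tupleCoboundary_apply, tupleCoboundary_apply]
      exact Finset.sum_congr rfl fun j _ ↦
        congrArg ((-1) ^ (j : ℕ) * ·) (hinv g (j.removeNth v))
    rw [Pi.sub_apply, Pi.sub_apply, hf, this]
  · rw [map_sub, hdf, tupleCoboundary_tupleCoboundary, sub_zero]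
  · rw [Pi.sub_apply, hns v hv, sub_self]

end LinearAlgebra

section Complements

variable {F V : Type} [Field F] [AddCommGroup V] [Module F V]

/-- The number of complements of a subspace is a power of the order of the field. -/
lemma exists_card_isCompl_eq_pow [Finite F] [FiniteDimensional F V] (W : Submodule F V) :
    ∃ a, Nat.card {Q : Submodule F V // IsCompl W Q} = Nat.card F ^ a := by
  obtain ⟨Q, hQ⟩ := W.exists_isCompl
  let f₀ := W.isComplEquivProj ⟨Q, hQ⟩
  let R : (V →ₗ[F] W) →ₗ[F] (W →ₗ[F] W) := LinearMap.lcomp F W W.subtype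
  let e : {f : V →ₗ[F] W // ∀ x : W, f x = x} ≃ LinearMap.ker R :=
    (Equiv.subRight f₀.1).subtypeEquiv fun f ↦ by
      rw [LinearMap.mem_ker, LinearMap.ext_iff]
      simp [R, f₀.2, sub_eq_zero]
  exact ⟨_, (Nat.card_congr (W.isComplEquivProj.trans e)).trans (Module.natCard_eq_pow_finrank)⟩

variable (F V) in
/-- The tuples of nonzero vectors together with a complement of their span. -/
abbrev TupleWithComplement (m : ℕ) : Type :=
  {p : (Fin m → {v : V // v ≠ 0}) × Submodule F V // IsCompl (tupleSpan F p.1) p.2}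

instance (m : ℕ) : MulAction (V ≃ₗ[F] V) (TupleWithComplement F V m) where
  smul g z := ⟨(g • z.1.1, z.1.2.map (g : V →ₗ[F] V)), by
    rw [tupleSpan_smul]
    exact z.2.map (Submodule.orderIsoMapComap g)⟩
  one_smul z := Subtype.ext (Prod.ext (one_smul _ z.1.1) (Submodule.map_id z.1.2))
  mul_smul g h z := Subtype.ext (Prod.ext (mul_smul g h z.1.1)
    (Submodule.map_comp (h : V →ₗ[F] V) (g : V →ₗ[F] V) z.1.2))

/-- The automorphism of `V` induced by the identity of `W` and an automorphism of the
complement `Q`. -/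
def extendOfIsCompl {W Q : Submodule F V} (h : IsCompl W Q) : (Q ≃ₗ[F] Q) →* (V ≃ₗ[F] V) where
  toFun g := (W.prodEquivOfIsCompl Q h).symm.trans
    (((LinearEquiv.refl F W).prodCongr g).trans (W.prodEquivOfIsCompl Q h))
  map_one' := LinearEquiv.ext fun x ↦ (W.prodEquivOfIsCompl Q h).apply_symm_apply x
  map_mul' a b := LinearEquiv.ext fun x ↦ by
    simp only [LinearEquiv.mul_apply, LinearEquiv.trans_apply, LinearEquiv.symm_apply_apply]
    rfl

lemma extendOfIsCompl_left {W Q : Submodule F V} (h : IsCompl W Q) (g : Q ≃ₗ[F] Q) (x : W) :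
    extendOfIsCompl h g x = x := by
  simp [extendOfIsCompl]

lemma extendOfIsCompl_right {W Q : Submodule F V} (h : IsCompl W Q) (g : Q ≃ₗ[F] Q) (x : Q) :
    extendOfIsCompl h g x = g x := by
  simp [extendOfIsCompl]

lemma apply_mem_complement {m : ℕ} {z : TupleWithComplement F V m}
    (g : MulAction.stabilizer (V ≃ₗ[F] V) z) {x : V} (hx : x ∈ z.1.2) :
    (g : V ≃ₗ[F] V) x ∈ z.1.2 := by
  have : z.1.2.map ((g : V ≃ₗ[F] V) : V →ₗ[F] V) = z.1.2 := congrArg (fun z ↦ z.1.2) g.2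
  rw [← this]
  exact Submodule.mem_map_of_mem hx

/-- The restriction of the stabilizer of a tuple with complement to the complement. -/
def stabilizerToComplement {m : ℕ} (z : TupleWithComplement F V m) :
    MulAction.stabilizer (V ≃ₗ[F] V) z →* (z.1.2 ≃ₗ[F] z.1.2) where
  toFun g := .ofLinearMap (((g : V ≃ₗ[F] V) : V →ₗ[F] V).restrict fun _ ↦ apply_mem_complement g)
    ((((g⁻¹ : MulAction.stabilizer (V ≃ₗ[F] V) z) : V ≃ₗ[F] V) : V →ₗ[F] V).restrict
      fun _ ↦ apply_mem_complement g⁻¹)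
    (LinearMap.ext fun x ↦ Subtype.ext ((g : V ≃ₗ[F] V).apply_symm_apply x))
    (LinearMap.ext fun x ↦ Subtype.ext ((g : V ≃ₗ[F] V).symm_apply_apply x))
  map_one' := rfl
  map_mul' _ _ := rfl

/-- The automorphisms of the complement act on a tuple with complement as stabilizers. -/
def complementToStabilizer {m : ℕ} (z : TupleWithComplement F V m) :
    (z.1.2 ≃ₗ[F] z.1.2) →* MulAction.stabilizer (V ≃ₗ[F] V) z :=
  (extendOfIsCompl z.2).codRestrict _ fun g ↦ by
    refine Subtype.ext (Prod.ext (funext fun i ↦ Subtype.ext ?_) ?_)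
    · exact extendOfIsCompl_left z.2 g ⟨_, mem_tupleSpan z.1.1 i⟩
    · change z.1.2.map (extendOfIsCompl z.2 g : V →ₗ[F] V) = z.1.2
      apply le_antisymm
      · rintro _ ⟨x, hx, rfl⟩
        exact (extendOfIsCompl_right z.2 g ⟨x, hx⟩).symm ▸ (g ⟨x, hx⟩).2
      · intro x hx
        refine ⟨g.symm ⟨x, hx⟩, (g.symm ⟨x, hx⟩).2, ?_⟩
        exact (extendOfIsCompl_right z.2 g _).trans (by simp)

lemma complementToStabilizer_comp_stabilizerToComplement {m : ℕ} (z : TupleWithComplement F V m) :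
    (complementToStabilizer z).comp (stabilizerToComplement z) = .id _ := by
  refine MonoidHom.ext fun g ↦ Subtype.ext (LinearEquiv.ext fun x ↦ ?_)
  obtain ⟨a, ha, b, hb, rfl⟩ := Submodule.mem_sup.1 (z.2.sup_eq_top ▸ Submodule.mem_top (x := x))
  have hg : (g : V ≃ₗ[F] V) • z.1.1 = z.1.1 := congrArg (fun z ↦ z.1.1) g.2
  change extendOfIsCompl z.2 (stabilizerToComplement z g) (a + b) = (g : V ≃ₗ[F] V) (a + b)
  rw [map_add, map_add, smul_eq_self_of_mem_tupleSpan hg ha, extendOfIsCompl_left z.2 _ ⟨a, ha⟩,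
    extendOfIsCompl_right z.2 _ ⟨b, hb⟩]
  rfl

variable {k : Type} [Field k] {N : ℕ}

/-- If the general linear groups of smaller spaces are acyclic in a range, so are the functions
on tuples of nonzero vectors. -/
lemma acyclicBelow_funRep_tuples [Finite F] [FiniteDimensional F V] (hF : (Nat.card F : k) ≠ 0)
    (ih : ∀ Q : Submodule F V, Module.finrank F Q < Module.finrank F V →
      AcyclicBelow (Rep.trivial k (Q ≃ₗ[F] Q) k) N) {m : ℕ} (hm : 1 ≤ m) :
    AcyclicBelow (funRep k (V ≃ₗ[F] V) (Fin m → {v : V // v ≠ 0})) N := by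
  have : Finite V := Module.finite_of_finite F
  refine AcyclicBelow.funRep_of_fibers (Z := TupleWithComplement F V m) (fun z ↦ z.1.1)
    (fun _ _ ↦ rfl) (fun v ↦ ?_) (AcyclicBelow.funRep_of_stabilizer fun z ↦ ?_)
  · obtain ⟨a, ha⟩ := exists_card_isCompl_eq_pow (tupleSpan F v)
    let e : {z : TupleWithComplement F V m // z.1.1 = v} ≃
        {Q : Submodule F V // IsCompl (tupleSpan F v) Q} :=
      { toFun z := ⟨z.1.1.2, by obtain ⟨z, rfl⟩ := z; exact z.2⟩
        invFun Q := ⟨⟨(v, Q.1), Q.2⟩, rfl⟩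
        left_inv := by rintro ⟨z, rfl⟩; rfl
        right_inv _ := rfl }
    rw [Nat.card_congr e, ha, Nat.cast_pow]
    exact pow_ne_zero a hF
  · refine AcyclicBelow.trivial_of_retract _ _
      (complementToStabilizer_comp_stabilizerToComplement z) (ih _ (Submodule.finrank_lt ?_))
    intro h
    have h₀ : tupleSpan F z.1.1 = ⊥ := eq_bot_of_isCompl_top (h ▸ z.2)
    exact (z.1.1 ⟨0, hm⟩).2 <| (Submodule.mem_bot F).1 (h₀ ▸ mem_tupleSpan z.1.1 ⟨0, hm⟩)

/-- The trivial representation is acyclic in a range if the functions on some finite `G`-set of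
invertible cardinality are. -/
lemma AcyclicBelow.trivial_of_card {G Y : Type} [Group G] [MulAction G Y] [Fintype Y]
    (hY : (Fintype.card Y : k) ≠ 0) (h : AcyclicBelow (funRep k G Y) N) :
    AcyclicBelow (Rep.trivial k G k) N := by
  refine h.of_retract
    (Rep.homMk (A := Rep.trivial k G k) (LinearMap.pi fun _ : Y ↦ .id) fun _ _ ↦ rfl)
    (Rep.homMk (B := Rep.trivial k G k)
      ((Fintype.card Y : k)⁻¹ • ∑ y : Y, LinearMap.proj (R := k) (φ := fun _ : Y ↦ k) y) ?_) ?_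
  · intro g (f : Y → k)
    have : ∑ y, f (g⁻¹ • y) = ∑ y, f y := Equiv.sum_comp (MulAction.toPerm g⁻¹) f
    simp [LinearMap.sum_apply, this]
  · refine Rep.hom_ext_apply fun (c : k) ↦ ?_
    change ((Fintype.card Y : k)⁻¹ • ∑ y : Y, LinearMap.proj (R := k) (φ := fun _ : Y ↦ k) y)
      (fun _ ↦ c) = c
    simp [LinearMap.sum_apply, hY]

/-- The mod `k` cohomology of the general linear group of a finite vector space vanishes below
the multiplicative order of `q` in `k`. -/
lemma acyclicBelow_trivial_linearEquiv [Finite F] [FiniteDimensional F V]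
    (hF : (Nat.card F : k) ≠ 0) (h2 : (2 : k) ≠ 0)
    (hN : ∀ i, 0 < i → i < N → (Nat.card F : k) ^ i ≠ 1) :
    AcyclicBelow (Rep.trivial k (V ≃ₗ[F] V) k) N := by
  induction hd : Module.finrank F V using Nat.strong_induction_on generalizing V with
  | _ d ih =>
  have : Finite V := Module.finite_of_finite F
  have := Fintype.ofFinite V
  classical
  rcases Nat.eq_zero_or_pos d with rfl | hd0
  · have := Module.finrank_zero_iff.1 hd
    have : Subsingleton (V ≃ₗ[F] V) := ⟨fun _ _ ↦ LinearEquiv.ext fun _ ↦ Subsingleton.elim _ _⟩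
    intro i hi _
    obtain ⟨i, rfl⟩ : ∃ j, i = j + 1 := ⟨i - 1, by omega⟩
    exact isZero_groupCohomology_succ_of_subsingleton _ i
  have hC (m : ℕ) (hm : 1 ≤ m) :
      AcyclicBelow (funRep k (V ≃ₗ[F] V) (Fin m → {v : V // v ≠ 0})) N :=
    acyclicBelow_funRep_tuples hF (fun Q hQ ↦ ih _ (hd ▸ hQ) rfl) hm
  rcases lt_or_ge d N with hdN | hdN
  · refine AcyclicBelow.trivial_of_card ?_ (hC 1 le_rfl)
    have hcard : Fintype.card V = Nat.card F ^ d := by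
      rw [← Nat.card_eq_fintype_card, ← hd, Module.natCard_eq_pow_finrank (K := F)]
    rw [Fintype.card_fun, Fintype.card_fin, pow_one, Fintype.card_subtype_compl,
      Fintype.card_subtype_eq, hcard,
      Nat.cast_sub (Nat.one_le_pow _ _ Nat.card_pos), Nat.cast_pow, Nat.cast_one, sub_ne_zero]
    exact hN d hd0 hdN
  · have : Nontrivial V := Module.nontrivial_of_finrank_pos (R := F) (hd ▸ hd0)
    have : Nonempty {v : V // v ≠ 0} := nonempty_subtype.2 (exists_ne 0)
    exact AcyclicBelow.trivial_of_tuples hC fun m hm hmN f hf hdf ↦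
      exists_invariant_tupleCoboundary_eq h2 hm (by omega) hf hdf

end Complements

/-- let `G = GLₙ(q)` and `k` an algebraically closed field of
characteristic `r > 0` with `r ∤ q(q-1)`. If `l` is the multiplicative order of
`q` modulo `r` and `l ≥ 3`, then `Hⁱ(G, k) = 0` for `1 ≤ i ≤ l - 1`. -/
theorem groupCohomology_GL_trivial_eq_zero
    (n : ℕ) (hn : 0 < n) (q : ℕ) (hq : IsPrimePow q)
    (F : Type) [Field F] [Fintype F] (hF : Fintype.card F = q)
    (k : Type) [Field k] [IsAlgClosed k]
    (r : ℕ) (hr : ringChar k = r) (hr0 : 0 < r) (hrq : ¬ r ∣ q * (q - 1))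
    (l : ℕ) (hl : l = orderOf (q : ZMod r)) (hl3 : 3 ≤ l) :
    ∀ i : ℕ, 1 ≤ i → i ≤ l - 1 →
      Subsingleton (groupCohomology (Rep.trivial k (GL (Fin n) F) k) i) := by
  intro i hi hil
  have : CharP k r := ringChar.of_eq hr
  have hcast (a : ℕ) : (Nat.card F : k) ^ a = ZMod.castHom dvd_rfl k ((q : ZMod r) ^ a) := by
    simp [← hF]
  have hqk : (Nat.card F : k) ≠ 0 := by
    rw [Nat.card_eq_fintype_card, hF, Ne, CharP.cast_eq_zero_iff k r]
    exact fun h ↦ hrq (h.mul_right _)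
  have h2 : (2 : k) ≠ 0 := by
    intro h
    have h2r : r ∣ 2 := (CharP.cast_eq_zero_iff k r 2).1 (by exact_mod_cast h)
    exact hrq <| h2r.trans (Nat.even_mul_pred_self q).two_dvd
  have hN (a : ℕ) (ha : 0 < a) (hal : a < l) : (Nat.card F : k) ^ a ≠ 1 := by
    rw [hcast, Ne, map_eq_one_iff _ (ZMod.castHom_injective k)]
    exact pow_ne_one_of_lt_orderOf ha.ne' (hl ▸ hal)
  let e : GL (Fin n) F ≃* ((Fin n → F) ≃ₗ[F] (Fin n → F)) :=
    Matrix.GeneralLinearGroup.toLin.trans (LinearMap.GeneralLinearGroup.generalLinearEquiv F _)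
  have hA : AcyclicBelow (Rep.trivial k (GL (Fin n) F) k) l :=
    (acyclicBelow_trivial_linearEquiv hqk h2 hN).trivial_of_retract e.toMonoidHom
      e.symm.toMonoidHom (MonoidHom.ext e.symm_apply_apply)
  exact ModuleCat.subsingleton_of_isZero (hA i hi (by omega))
end
end

section
/- Let G = GL_4(F_7) be the group of invertible 4×4 matrices over the field with 7 elements, and let k be an algebraically closed field of characteristic 5. Then H^i(G, k) = 0 for i = 1, 2, 3, i.e., Ext^i_{kG}(k, k) = 0 for 1 ≤ i ≤ 3. -/
noncomputable section

section Vanishing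

open CategoryTheory Limits

namespace groupCohomology

universe u

variable {k G : Type u} [CommRing k] [Group G]

lemma isZero_of_retract {A B : Rep.{u} k G} (i : A ⟶ B) (r : B ⟶ A) (h : i ≫ r = 𝟙 A) (n : ℕ)
    (hB : IsZero (groupCohomology B n)) : IsZero (groupCohomology A n) := by
  rw [IsZero.iff_id_eq_zero]
  have h1 : (functor k G n).map i ≫ (functor k G n).map r = 𝟙 ((functor k G n).obj A) := by
    rw [← Functor.map_comp, h, CategoryTheory.Functor.map_id]
  have h2 : (functor k G n).map i = 0 := IsZero.eq_zero_of_tgt hB _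
  rw [h2, zero_comp] at h1
  exact h1.symm

lemma isZero_succ_of_exact {S : ShortComplex (Rep.{u} k G)} (hS : S.Exact) [Mono S.f] (n : ℕ)
    (hI : IsZero (groupCohomology S.X₂ (n + 1)))
    (hQ : IsZero (groupCohomology (image S.g) n)) : IsZero (groupCohomology S.X₁ (n + 1)) := by
  have w : S.f ≫ factorThruImage S.g = 0 := by
    rw [← cancel_mono (image.ι S.g)]; simp
  let T : ShortComplex (Rep k G) := ShortComplex.mk S.f (factorThruImage S.g) w
  let F : T ⟶ S := { τ₁ := 𝟙 _, τ₂ := 𝟙 _, τ₃ := image.ι S.g }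
  have : Epi F.τ₁ := inferInstanceAs (Epi (𝟙 _))
  have : IsIso F.τ₂ := inferInstanceAs (IsIso (𝟙 _))
  have : Mono F.τ₃ := inferInstanceAs (Mono (image.ι _))
  have hT : T.ShortExact :=
    { exact := (ShortComplex.exact_iff_of_epi_of_isIso_of_mono F).2 hS
      mono_f := ‹_›
      epi_g := inferInstanceAs (Epi (factorThruImage S.g)) }
  have := epi_δ_of_isZero hT n hI
  exact IsZero.of_epi (δ hT n (n + 1) rfl) hQ

/-- The complex obtained by replacing the first map by the inclusion of its image. -/
abbrev imageComplex (S : ShortComplex (Rep.{u} k G)) : ShortComplex (Rep.{u} k G) :=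
  ShortComplex.mk (image.ι S.f) S.g (by
    rw [← cancel_epi (factorThruImage S.f)]; simp)

lemma imageComplex_exact {S : ShortComplex (Rep.{u} k G)} (hS : S.Exact) :
    (imageComplex S).Exact := by
  let F : S ⟶ imageComplex S := { τ₁ := factorThruImage S.f, τ₂ := 𝟙 _, τ₃ := 𝟙 _ }
  have : Epi F.τ₁ := inferInstanceAs (Epi (factorThruImage S.f))
  have : IsIso F.τ₂ := inferInstanceAs (IsIso (𝟙 _))
  have : Mono F.τ₃ := inferInstanceAs (Mono (𝟙 _))
  exact (ShortComplex.exact_iff_of_epi_of_isIso_of_mono F).1 hS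

lemma isZero_zero_of_mono {A B : Rep.{u} k G} (f : A ⟶ B) [Mono f]
    (hB : IsZero (groupCohomology B 0)) : IsZero (groupCohomology A 0) :=
  IsZero.of_mono (map (MonoidHom.id G) f 0) hB

lemma exact_of_function_exact {A B C : Rep.{u} k G} (f : A ⟶ B) (g : B ⟶ C) (w : f ≫ g = 0)
    (h : ∀ b, g.hom b = 0 → ∃ a, f.hom a = b) : (ShortComplex.mk f g w).Exact := by
  rw [← ShortComplex.exact_map_iff_of_faithful _ (forget₂ (Rep k G) (ModuleCat k)),
    ShortComplex.moduleCat_exact_iff]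
  exact h

end groupCohomology

namespace Module.End

section Eigen

variable {k V : Type*} [Field k] [AddCommGroup V] [Module k V]

/-- In characteristic `5`, the projection onto the `c`-eigenspace of an operator whose fourth
power is `1`. -/
def eigenProj (Φ : Module.End k V) (c : k) : Module.End k V :=
  -(1 + c ^ 3 • Φ + c ^ 2 • Φ ^ 2 + c • Φ ^ 3)

lemma apply_eigenProj {Φ : Module.End k V} (hΦ : Φ ^ 4 = 1) {c : k} (hc : c ^ 4 = 1) (v : V) :
    Φ (eigenProj Φ c v) = c • eigenProj Φ c v := by
  have h1 : Φ (Φ (Φ (Φ v))) = v := congr($hΦ v)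
  simp only [eigenProj, LinearMap.neg_apply, LinearMap.add_apply, LinearMap.smul_apply, pow_succ,
    pow_zero, Module.End.mul_apply, Module.End.one_apply, map_neg, map_add, map_smul, h1]
  linear_combination (norm := module) hc • Φ v

lemma eigenProj_apply_of_eq [CharP k 5] {Φ : Module.End k V} {c : k} (hc : c ^ 4 = 1) {v : V}
    (hv : Φ v = c • v) : eigenProj Φ c v = v := by
  have h5 : (5 : k) = 0 := mod_cast CharP.cast_eq_zero k 5
  simp only [eigenProj, LinearMap.neg_apply, LinearMap.add_apply, LinearMap.smul_apply, pow_succ,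
    pow_zero, Module.End.mul_apply, Module.End.one_apply, map_smul, hv]
  linear_combination (norm := module) (-3 * hc - h5) • v

lemma eigenProj_mul {Φ T : Module.End k V} {c d : k} (hd : d ^ 4 = 1)
    (hT : Φ * T = d • (T * Φ)) (v : V) : eigenProj Φ (d * c) (T v) = T (eigenProj Φ c v) := by
  have h1 : ∀ v, Φ (T v) = d • T (Φ v) := fun v => congr($hT v)
  simp only [eigenProj, LinearMap.neg_apply, LinearMap.add_apply, LinearMap.smul_apply, pow_succ,
    pow_zero, Module.End.mul_apply, Module.End.one_apply, map_smul, h1, map_neg, map_add]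
  linear_combination (norm := module) (-c^3 * hd) • T (Φ v) -
    (c^2 * hd) • T (Φ (Φ v)) - (c * hd) • T (Φ (Φ (Φ v)))

/-- If an eigenvector of `Φ` lies in the range of an operator `T` that is semi-invariant under `Φ`,
then it is the image of an eigenvector. -/
lemma exists_eigenvector_apply_eq [CharP k 5] {Φ T : Module.End k V} (hΦ : Φ ^ 4 = 1) {c d : k}
    (hc : c ^ 4 = 1) (hd : d ^ 4 = 1) (hT : Φ * T = d • (T * Φ)) (v : V)
    (hv : Φ (T v) = (d * c) • T v) : ∃ w, Φ w = c • w ∧ T w = T v :=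
  ⟨eigenProj Φ c v, apply_eigenProj hΦ hc v, by
    rw [← eigenProj_mul hd hT, eigenProj_apply_of_eq (by rw [mul_pow, hc, hd, one_mul]) hv]⟩

end Eigen

end Module.End

section Kummer

variable {R : Type*} [Ring R]

/-- For an element `X` with `X ^ 25 = 1` and an automorphism acting by `X ↦ X ^ 7`, this is an
eigenvector for the eigenvalue `2` modulo `5`. -/
def kummer (X : R) : R := X + 3 * X ^ 7 + 4 * X ^ 24 + 2 * X ^ 18

/-- The norm element of the cyclic group of order `25` generated by `X`. -/
def normElt (X : R) : R := ∑ i ∈ Finset.range 25, X ^ i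

variable {X Φ : R}

lemma mul_pow_of_mul (h : Φ * X = X ^ 7 * Φ) (n : ℕ) : Φ * X ^ n = X ^ (7 * n) * Φ := by
  induction n with
  | zero => simp
  | succ n ih => rw [pow_succ, ← mul_assoc, ih, mul_assoc, h, ← mul_assoc, ← pow_add]; rfl

lemma mul_kummer (h5 : (5 : R) = 0) (hX : X ^ 25 = 1) (h : Φ * X = X ^ 7 * Φ) :
    Φ * kummer X = 2 * (kummer X * Φ) := by
  have h49 : X ^ 49 = X ^ 24 := pow_eq_pow_mod 49 hX
  have h168 : X ^ 168 = X ^ 18 := pow_eq_pow_mod 168 hX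
  have h126 : X ^ 126 = X := (pow_eq_pow_mod 126 hX).trans (pow_one X)
  have e : Φ * kummer X = (X ^ 7 + 3 * X ^ 24 + 4 * X ^ 18 + 2 * X) * Φ := by
    have hn (n m : ℕ) : Φ * (n * X ^ m) = n * X ^ (7 * m) * Φ := by
      rw [← mul_assoc, (Nat.cast_commute n Φ).symm.eq, mul_assoc, mul_pow_of_mul h, mul_assoc]
    have h3 := hn 3 7
    have h4 := hn 4 24
    have h2 := hn 2 18
    simp only [Nat.cast_ofNat, Nat.reduceMul, h49, h168, h126] at h2 h3 h4
    simp only [kummer, mul_add, add_mul, h2, h3, h4, h]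
  have e' : 2 * kummer X - (X ^ 7 + 3 * X ^ 24 + 4 * X ^ 18 + 2 * X) =
      5 * (X ^ 7 + X ^ 24) := by
    rw [kummer]; noncomm_ring
  rw [e, ← mul_assoc]
  rw [h5, zero_mul, sub_eq_zero] at e'
  rw [e']

lemma mul_normElt (hX : X ^ 25 = 1) (h : Φ * X = X ^ 7 * Φ) :
    Φ * normElt X = normElt X * Φ := by
  have hp (n : ℕ) := pow_eq_pow_mod n hX
  have e : ∑ i ∈ Finset.range 25, X ^ (7 * i) = normElt X := by
    refine Finset.sum_nbij' (fun i => 7 * i % 25) (fun i => 18 * i % 25) ?_ ?_ ?_ ?_ ?_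
    · intro i _; simp; lia
    · intro i _; simp; lia
    · intro i hi; simp at hi ⊢; lia
    · intro i hi; simp at hi ⊢; lia
    · intro i _; exact hp _
  conv_rhs => rw [← e]
  rw [Finset.sum_mul, normElt, Finset.mul_sum]
  exact Finset.sum_congr rfl fun i _ => mul_pow_of_mul h i

lemma normElt_mul_pow (hX : X ^ 25 = 1) (n : ℕ) : normElt X * X ^ n = normElt X := by
  have h1 : normElt X * X = normElt X := by
    have := geom_sum_mul X 25
    rw [hX, sub_self, mul_sub, mul_one, sub_eq_zero] at this
    exact this
  induction n with
  | zero => simp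
  | succ n ih => rw [pow_succ, ← mul_assoc, ih, h1]

lemma normElt_commute_kummer : Commute (normElt X) (kummer X) := by
  have h : Commute (normElt X) X := Commute.sum_left _ _ _ fun i _ => Commute.pow_self X i
  have hn (n : ℕ) [n.AtLeastTwo] : Commute (normElt X) (OfNat.ofNat n : R) :=
    Commute.ofNat_right _ n
  exact (((h.add_right ((hn 3).mul_right (h.pow_right 7))).add_right
    ((hn 4).mul_right (h.pow_right 24))).add_right ((hn 2).mul_right (h.pow_right 18)))

lemma normElt_mul_kummer (h5 : (5 : R) = 0) (hX : X ^ 25 = 1) : normElt X * kummer X = 0 := by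
  have hn (n m : ℕ) : normElt X * (n * X ^ m) = n * normElt X := by
    rw [← mul_assoc, (Nat.cast_commute n (normElt X)).symm.eq, mul_assoc, normElt_mul_pow hX]
  have h1 : normElt X * X = normElt X := by simpa using normElt_mul_pow hX 1
  have h3 := hn 3 7
  have h4 := hn 4 24
  have h2 := hn 2 18
  simp only [Nat.cast_ofNat] at h2 h3 h4
  have e : normElt X * kummer X = 5 * (2 * normElt X) := by
    simp only [kummer, mul_add, h1, h2, h3, h4]
    noncomm_ring
  rw [e, h5, zero_mul]

lemma kummer_mul_normElt (h5 : (5 : R) = 0) (hX : X ^ 25 = 1) : kummer X * normElt X = 0 := by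
  rw [← normElt_commute_kummer.eq, normElt_mul_kummer h5 hX]

end Kummer

open Polynomial in
/-- In characteristic `5`, the elements `X - 1` and `kummer X` differ by a unit that commutes
with `X`. -/
lemma exists_mul_kummer_eq {k R : Type*} [Field k] [CharP k 5] [Ring R] [Algebra k R] {X : R}
    (hX : X ^ 25 = 1) : ∃ a : R, a * kummer X = X - 1 ∧ kummer X * a = X - 1 := by
  have h5 : (5 : k) = 0 := mod_cast CharP.cast_eq_zero k 5
  have h5' : (5 : k[X]) = 0 := mod_cast CharP.cast_eq_zero k[X] 5
  have : Fact (Nat.Prime 5) := ⟨by norm_num⟩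
  let g (n : ℕ) : k[X] := ∑ i ∈ Finset.range n, Polynomial.X ^ i
  let w : k[X] := 1 + 3 * g 7 + 4 * g 24 + 2 * g 18
  have hw : kummer (Polynomial.X : k[X]) = w * (Polynomial.X - 1) := by
    have e (n : ℕ) : g n * (Polynomial.X - 1) = Polynomial.X ^ n - 1 := geom_sum_mul _ _
    have : w * (Polynomial.X - 1) = (Polynomial.X - 1) + 3 * (g 7 * (Polynomial.X - 1)) +
      4 * (g 24 * (Polynomial.X - 1)) + 2 * (g 18 * (Polynomial.X - 1)) := by ring
    rw [this, e, e, e, kummer]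
    linear_combination 2 * h5'
  have hw1 : w.eval 1 ≠ 0 := by
    have : w.eval 1 = -1 := by
      simp [w, g, eval_finsetSum]
      linear_combination 31 * h5
    rw [this]; simp
  have hcop : IsCoprime w ((Polynomial.X - 1) ^ 25) := by
    refine IsCoprime.pow_right ?_
    rw [← C_1, isCoprime_comm]
    exact ((irreducible_X_sub_C 1).coprime_iff_not_dvd).2 (by rwa [dvd_iff_isRoot])
  obtain ⟨a, b, hab⟩ := hcop
  have hab' : a * w + b * (Polynomial.X ^ 25 - 1) = 1 := by
    rw [show (25 : ℕ) = 5 ^ 2 by norm_num, sub_pow_char_pow, one_pow] at hab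
    exact hab
  have hmul : a * kummer (Polynomial.X : k[X]) =
      Polynomial.X - 1 - b * (Polynomial.X - 1) * (Polynomial.X ^ 25 - 1) := by
    rw [hw]; linear_combination (Polynomial.X - 1) * hab'
  have ev : aeval X (kummer (Polynomial.X : k[X])) = kummer X := by simp [kummer, map_ofNat]
  have h1 : aeval X a * kummer X = X - 1 := by
    rw [← ev, ← map_mul, hmul]; simp [hX]
  refine ⟨aeval X a, h1, ?_⟩
  rw [← h1, ← ev, ← map_mul, ← map_mul, mul_comm]

section Exactness

variable {k V : Type*} [Field k] [AddCommGroup V] [Module k V]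
  {X θ : Module.End k V}

lemma normElt_apply_of_fixed (hθ : ∑ i ∈ Finset.range 25, X ^ i * θ * X ^ (25 - i) = 1) {v : V}
    (hv : X v = v) : normElt X (θ v) = v := by
  have hp (n : ℕ) : (X ^ n) v = v := by
    rw [Module.End.pow_apply]; exact Function.iterate_fixed hv n
  have := congr($hθ v)
  simp only [LinearMap.sum_apply, Module.End.mul_apply, hp, Module.End.one_apply] at this
  simpa only [normElt, LinearMap.sum_apply] using this

variable [CharP k 5]

lemma fixed_of_kummer_apply_eq_zero (hX : X ^ 25 = 1) {v : V} (hv : kummer X v = 0) :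
    X v = v := by
  obtain ⟨a, ha, -⟩ := exists_mul_kummer_eq (k := k) hX
  have := congr($ha v)
  rwa [Module.End.mul_apply, hv, map_zero, LinearMap.sub_apply, Module.End.one_apply, eq_comm,
    sub_eq_zero] at this

lemma exists_kummer_apply_eq (hX : X ^ 25 = 1)
    (hθ : ∑ i ∈ Finset.range 25, X ^ i * θ * X ^ (25 - i) = 1) {v : V}
    (hv : normElt X v = 0) : ∃ w, kummer X w = v := by
  obtain ⟨a, -, ha⟩ := exists_mul_kummer_eq (k := k) hX
  let y (i : ℕ) : V := θ ((X ^ (25 - i)) v)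
  have hy : ∑ i ∈ Finset.range 25, y i = 0 := by
    have e : ∑ i ∈ Finset.range 25, X ^ (25 - i) = X * normElt X := by
      rw [normElt, ← Finset.sum_range_reflect, Finset.mul_sum]
      refine Finset.sum_congr rfl fun i hi => ?_
      rw [← pow_succ']
      congr 1
      have := Finset.mem_range.1 hi
      lia
    rw [← map_sum, ← LinearMap.sum_apply, e, Module.End.mul_apply, hv, map_zero, map_zero]
  have hv' : ∑ i ∈ Finset.range 25, (X ^ i) (y i) = v := by
    simpa only [LinearMap.sum_apply, Module.End.mul_apply, Module.End.one_apply] using congr($hθ v)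
  have hd (i : ℕ) : (X ^ i) (y i) = (X - 1) ((∑ j ∈ Finset.range i, X ^ j) (y i)) + y i := by
    rw [← Module.End.mul_apply (X - 1), mul_geom_sum]
    simp
  refine ⟨a (∑ i ∈ Finset.range 25, (∑ j ∈ Finset.range i, X ^ j) (y i)), ?_⟩
  rw [← Module.End.mul_apply, ha, map_sum]
  conv_rhs => rw [← hv', Finset.sum_congr rfl fun i _ => hd i, Finset.sum_add_distrib, hy, add_zero]

end Exactness

namespace Representation

section RightRegular

variable (k G : Type*) [Field k] [Group G]

/-- The action of `G` on functions `G → k` by right translation. -/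
def rightRegular : Representation k G (G → k) where
  toFun g := LinearMap.funLeft k k (· * g)
  map_one' := by ext; simp
  map_mul' _ _ := by ext; simp [mul_assoc]

variable {G}

@[simp] lemma rightRegular_apply (g : G) (f : G → k) (a : G) :
    rightRegular k G g f a = f (a * g) := rfl

/-- The operator of left translation on functions `G → k`. -/
def leftTranslate (x : G) : Module.End k (G → k) := LinearMap.funLeft k k (x * ·)

@[simp] lemma leftTranslate_apply (x : G) (f : G → k) (a : G) :
    leftTranslate k x f a = f (x * a) := rfl

lemma leftTranslate_mul (x y : G) :
    leftTranslate k (x * y) = leftTranslate k y * leftTranslate k x := by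
  ext; simp [mul_assoc]

lemma leftTranslate_one : leftTranslate k (1 : G) = 1 := by
  ext; simp

lemma leftTranslate_pow (x : G) (n : ℕ) : leftTranslate k (x ^ n) = leftTranslate k x ^ n := by
  induction n with
  | zero => simp [leftTranslate_one]
  | succ n ih => rw [pow_succ', leftTranslate_mul, ih, pow_succ]

variable {k}

/-- The subring of the operators that commute with all right translations. -/
def rightCommutant (k G : Type*) [Field k] [Group G] : Subalgebra k (Module.End k (G → k)) :=
  Subalgebra.centralizer k (Set.range (rightRegular k G))

lemma mem_rightCommutant {T : Module.End k (G → k)} :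
    T ∈ rightCommutant k G ↔ ∀ g, rightRegular k G g * T = T * rightRegular k G g := by
  simp [rightCommutant, Subalgebra.mem_centralizer_iff]

lemma leftTranslate_mem_rightCommutant (x : G) : leftTranslate k x ∈ rightCommutant k G :=
  mem_rightCommutant.2 fun g => by ext; simp [mul_assoc]

/-- The functions on which left translation by `φ` acts as the scalar `c`. -/
def eigenRep (φ : G) (c : k) : Subrepresentation (rightRegular k G) where
  toSubmodule := LinearMap.ker (leftTranslate k φ - c • 1)
  apply_mem_toSubmodule g f hf := by
    simp only [LinearMap.mem_ker, LinearMap.sub_apply, LinearMap.smul_apply,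
      Module.End.one_apply, sub_eq_zero] at hf ⊢
    ext a
    simpa [mul_assoc] using congrFun hf (a * g)

lemma mem_eigenRep {φ : G} {c : k} {f : G → k} :
    f ∈ (eigenRep φ c).toSubmodule ↔ leftTranslate k φ f = c • f := by
  simp [eigenRep, sub_eq_zero]

/-- An operator commuting with the action restricts to an intertwining map between
subrepresentations. -/
def restrictIntertwining {S S' : Subrepresentation (rightRegular k G)}
    (T : Module.End k (G → k)) (hT : T ∈ rightCommutant k G)
    (h : ∀ f ∈ S.toSubmodule, T f ∈ S'.toSubmodule) :
    S.toRepresentation.IntertwiningMap S'.toRepresentation where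
  toLinearMap := T.restrict h
  isIntertwining' g := by
    ext1 f
    exact Subtype.ext congr($((mem_rightCommutant.1 hT g).symm) f.1)

end RightRegular

end Representation

namespace groupCohomology

open Representation

universe u

variable {k G : Type u} [Field k] [Group G]

lemma isZero_rightRegular (n : ℕ) :
    IsZero (groupCohomology (Rep.of (rightRegular k G)) (n + 1)) := by
  let A : Rep k (⊥ : Subgroup G) := Rep.trivial k _ k
  refine isZero_of_retract (B := Rep.coind (⊥ : Subgroup G).subtype A)
    (Rep.ofHom ⟨LinearMap.codRestrict _ LinearMap.id fun f g h => ?_, fun g => ?_⟩)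
    (Rep.ofHom ⟨Submodule.subtype _, fun g => ?_⟩) ?_ _
    ((isZero_groupCohomology_succ_of_subsingleton A n).of_iso (coindIso A _))
  · obtain rfl := Subsingleton.elim g 1
    simp
  · rfl
  · rfl
  · rfl

lemma isZero_eigenRep [CharP k 5] {φ : G} (hφ : φ ^ 4 = 1) {c : k} (hc : c ^ 4 = 1) (n : ℕ) :
    IsZero (groupCohomology (Rep.of (eigenRep φ c).toRepresentation) (n + 1)) := by
  have hΦ : leftTranslate k φ ^ 4 = 1 := by rw [← leftTranslate_pow, hφ, leftTranslate_one]
  have hmem : Module.End.eigenProj (leftTranslate k φ) c ∈ rightCommutant k G := by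
    have h := leftTranslate_mem_rightCommutant (k := k) φ
    exact neg_mem (add_mem (add_mem (add_mem (one_mem _) (Subalgebra.smul_mem _ h _))
      (Subalgebra.smul_mem _ (pow_mem h 2) _)) (Subalgebra.smul_mem _ (pow_mem h 3) _))
  refine isZero_of_retract
    (Rep.ofHom ⟨(eigenRep φ c).toSubmodule.subtype, fun g => rfl⟩)
    (Rep.ofHom ⟨LinearMap.codRestrict _ (Module.End.eigenProj (leftTranslate k φ) c)
      fun f => mem_eigenRep.2 (Module.End.apply_eigenProj hΦ hc f), fun g => ?_⟩) ?_ _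
    (isZero_rightRegular (k := k) (G := G) n)
  · ext1 f
    exact Subtype.ext congr($((mem_rightCommutant.1 hmem g).symm) f)
  · ext1
    refine Representation.IntertwiningMap.ext ?_
    ext1 f
    exact Subtype.ext (Module.End.eigenProj_apply_of_eq hc (mem_eigenRep.1 f.2))

lemma isZero_zero_eigenRep {φ : G} {c : k} (hc : c ≠ 1) :
    IsZero (groupCohomology (Rep.of (eigenRep φ c).toRepresentation) 0) := by
  refine IsZero.of_iso ?_ (H0Iso _)
  rw [ModuleCat.isZero_iff_subsingleton]
  refine subsingleton_of_forall_eq 0 fun f => Subtype.ext (Subtype.ext (funext fun a => ?_))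
  have hinv (g : G) : f.1.1 (a * g) = f.1.1 a := congrFun congr(($(f.2 g)).1) a
  have h1 : f.1.1 (φ * a) = c * f.1.1 a := congrFun (mem_eigenRep.1 f.1.2) a
  have h2 : f.1.1 (φ * a) = f.1.1 a := by
    simpa [mul_assoc] using hinv (a⁻¹ * φ * a)
  have h3 : (c - 1) * f.1.1 a = 0 := by rw [sub_mul, ← h1, h2, one_mul, sub_self]
  exact (mul_eq_zero.1 h3).resolve_left (sub_ne_zero.2 hc)

end groupCohomology

section Transversal

variable {G : Type*} [Group G]

lemma exists_orbit_sum_eq_one {x : G} (hx : orderOf x = 25) :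
    ∃ τ : G → ℕ, ∀ g, ∑ i ∈ Finset.range 25, τ (x ^ i * g) = 1 := by
  classical
  let s : Setoid G := QuotientGroup.rightRel (Subgroup.zpowers x)
  have hs (a b : G) : s a b ↔ b * a⁻¹ ∈ Subgroup.zpowers x := QuotientGroup.rightRel_apply
  have hfin : IsOfFinOrder x := by rw [← orderOf_pos_iff, hx]; norm_num
  refine ⟨fun g => if (Quotient.mk s g).out = g then 1 else 0, fun g => ?_⟩
  have hmk (i : ℕ) : Quotient.mk s (x ^ i * g) = Quotient.mk s g :=
    Quotient.sound ((hs _ _).2 ⟨-i, by simp⟩)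
  have hout : (Quotient.mk s g).out * g⁻¹ ∈ Subgroup.zpowers x :=
    (hs _ _).1 (Quotient.exact (Quotient.out_eq (Quotient.mk s g)).symm)
  rw [hfin.mem_zpowers_iff_mem_range_orderOf, hx] at hout
  obtain ⟨j, hj, hjx⟩ := Finset.mem_image.1 hout
  have hjx' : (Quotient.mk s g).out = x ^ j * g := by rw [hjx]; simp
  simp only [hmk]
  rw [Finset.sum_eq_single_of_mem j hj, if_pos hjx']
  intro i hi hij
  refine if_neg fun h => hij ?_
  rw [hjx', mul_left_inj] at h
  refine pow_injOn_Iio_orderOf (x := x) ?_ ?_ h.symm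
  · simpa [hx] using hi
  · simpa [hx] using hj

variable {M : Type*} [CommRing M] [Fintype G]

/-- The sum of a left `x`-invariant function over representatives of the `x`-orbits, encoded by a
weight `τ`, is independent of the choice of `τ`. -/
lemma sum_weight_mul_eq {x : G} (hx : x ^ 25 = 1) {τ τ' : G → M}
    (h : ∀ g, ∑ i ∈ Finset.range 25, τ (x ^ i * g) = 1)
    (h' : ∀ g, ∑ i ∈ Finset.range 25, τ' (x ^ i * g) = 1) {f : G → M}
    (hf : ∀ g, f (x * g) = f g) : ∑ g, τ g * f g = ∑ g, τ' g * f g := by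
  have hf' (i : ℕ) (g : G) : f (x ^ i * g) = f g := by
    induction i with
    | zero => simp
    | succ i ih => rw [pow_succ', mul_assoc, hf, ih]
  have e (g : G) : ∑ i ∈ Finset.range 25, τ ((x ^ i)⁻¹ * g) = 1 := by
    rw [← h (x * g), ← Finset.sum_range_reflect]
    refine Finset.sum_congr rfl fun i hi => ?_
    have hxi : x ^ i * x * x ^ (25 - 1 - i) = 1 := by
      rw [← pow_succ, ← pow_add, ← hx]
      congr 1
      have := Finset.mem_range.1 hi
      lia
    rw [inv_eq_of_mul_eq_one_left hxi, mul_assoc]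
  calc ∑ g, τ g * f g = ∑ g, ∑ i ∈ Finset.range 25, τ g * τ' (x ^ i * g) * f (x ^ i * g) := by
        refine Finset.sum_congr rfl fun g _ => ?_
        simp only [hf', ← Finset.sum_mul, ← Finset.mul_sum, h', mul_one]
    _ = ∑ i ∈ Finset.range 25, ∑ g, τ ((x ^ i)⁻¹ * g) * τ' g * f g := by
        rw [Finset.sum_comm]
        refine Finset.sum_congr rfl fun i _ => ?_
        rw [← Equiv.sum_comp (Equiv.mulLeft (x ^ i)) (fun g => τ ((x ^ i)⁻¹ * g) * τ' g * f g)]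
        simp
    _ = ∑ g, τ' g * f g := by
        rw [Finset.sum_comm]
        refine Finset.sum_congr rfl fun g _ => ?_
        rw [← Finset.sum_mul, ← Finset.sum_mul, e, one_mul]

lemma twentyFive_mul_sum_weight {x : G} {τ : G → ℕ}
    (h : ∀ g, ∑ i ∈ Finset.range 25, τ (x ^ i * g) = 1) : 25 * ∑ g, τ g = Fintype.card G := by
  have : ∑ g, ∑ i ∈ Finset.range 25, τ (x ^ i * g) = Fintype.card G := by simp [h]
  have e (i : ℕ) : ∑ g, τ (x ^ i * g) = ∑ g, τ g := Equiv.sum_comp (Equiv.mulLeft (x ^ i)) τ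
  simp [← this, Finset.sum_comm (s := Finset.univ), e]

end Transversal

namespace groupCohomology

open Representation

universe u

variable {k G : Type u} [Field k] [Group G]

/-- The morphism between eigenspaces of left translation by `φ` given by an operator that is
semi-invariant under `φ`. -/
def eigenMap {φ : G} {c c' d : k} (T : Module.End k (G → k)) (hT : T ∈ rightCommutant k G)
    (h : leftTranslate k φ * T = d • (T * leftTranslate k φ)) (hc : c' = d * c) :
    Rep.of (eigenRep φ c).toRepresentation ⟶ Rep.of (eigenRep φ c').toRepresentation :=
  Rep.ofHom (restrictIntertwining T hT fun f hf => by
    rw [mem_eigenRep] at hf ⊢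
    rw [← Module.End.mul_apply, h, LinearMap.smul_apply, Module.End.mul_apply, hf, map_smul,
      smul_smul, hc])

lemma eigenMap_comp_eq_zero {φ : G} {c c' c'' d d' : k} {T T' : Module.End k (G → k)}
    {hT : T ∈ rightCommutant k G} {hT' : T' ∈ rightCommutant k G}
    {h : leftTranslate k φ * T = d • (T * leftTranslate k φ)}
    {h' : leftTranslate k φ * T' = d' • (T' * leftTranslate k φ)}
    {hc : c' = d * c} {hc' : c'' = d' * c'} (hTT : T' * T = 0) :
    eigenMap T hT h hc ≫ eigenMap T' hT' h' hc' = 0 := by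
  ext1
  refine Representation.IntertwiningMap.ext ?_
  ext1 f
  exact Subtype.ext congr($hTT f.1)

lemma eigenMap_exact [CharP k 5] {φ : G} (hφ : φ ^ 4 = 1) {c c' c'' d d' : k} (hc4 : c ^ 4 = 1)
    (hd4 : d ^ 4 = 1) {T T' : Module.End k (G → k)}
    {hT : T ∈ rightCommutant k G} {hT' : T' ∈ rightCommutant k G}
    {h : leftTranslate k φ * T = d • (T * leftTranslate k φ)}
    {h' : leftTranslate k φ * T' = d' • (T' * leftTranslate k φ)}
    {hc : c' = d * c} {hc' : c'' = d' * c'} (hTT : T' * T = 0)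
    (hex : ∀ f, T' f = 0 → ∃ f', T f' = f) :
    (ShortComplex.mk (eigenMap T hT h hc) (eigenMap T' hT' h' hc')
      (eigenMap_comp_eq_zero hTT)).Exact := by
  have hΦ : leftTranslate k φ ^ 4 = 1 := by rw [← leftTranslate_pow, hφ, leftTranslate_one]
  refine exact_of_function_exact _ _ _ fun f hf => ?_
  obtain ⟨f', hf'⟩ := hex f.1 congr(($hf).1)
  obtain ⟨w, hw, hw'⟩ := Module.End.exists_eigenvector_apply_eq hΦ hc4 hd4 h f' (by
    rw [hf', ← hc]; exact mem_eigenRep.1 f.2)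
  exact ⟨⟨w, mem_eigenRep.2 hw⟩, Subtype.ext (hw'.trans hf')⟩

/-- The trivial representation is a retract of the representation on functions invariant under
left translation by `x` and `φ`. -/
lemma exists_retract_trivial [CharP k 5] [Fintype G] {x : G} (hx : orderOf x = 25) (φ : G)
    (hG : ¬ 125 ∣ Fintype.card G) :
    ∃ (i : Rep.trivial k G k ⟶
        Rep.of (eigenRep (k := k) x 1 ⊓ eigenRep φ 1).toRepresentation)
      (r : Rep.of (eigenRep (k := k) x 1 ⊓ eigenRep φ 1).toRepresentation ⟶ Rep.trivial k G k),
      i ≫ r = 𝟙 _ := by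
  obtain ⟨τ, hτ⟩ := exists_orbit_sum_eq_one hx
  have hτk (g : G) : ∑ i ∈ Finset.range 25, (τ (x ^ i * g) : k) = 1 := by
    rw [← Nat.cast_sum, hτ, Nat.cast_one]
  have hm : ((∑ g, τ g : ℕ) : k) ≠ 0 := by
    rw [Ne, CharP.cast_eq_zero_iff k 5]
    rintro ⟨t, ht⟩
    refine hG ⟨t, ?_⟩
    rw [← twentyFive_mul_sum_weight hτ, ht]
    ring
  set m : k := ((∑ g, τ g : ℕ) : k) with hmdef
  let ι : k →ₗ[k] (eigenRep (k := k) x 1 ⊓ eigenRep φ 1).toSubmodule :=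
    LinearMap.codRestrict _ (LinearMap.pi fun _ => LinearMap.id) fun c =>
      ⟨mem_eigenRep.2 (by ext; simp), mem_eigenRep.2 (by ext; simp)⟩
  let s : (G → k) →ₗ[k] k := m⁻¹ • ∑ g, (τ g : k) • LinearMap.proj g
  have hs (f : G → k) : s f = m⁻¹ * ∑ g, (τ g : k) * f g := by simp [s]
  refine ⟨Rep.ofHom ⟨ι, fun g => rfl⟩, Rep.ofHom ⟨s ∘ₗ Submodule.subtype _, fun a => ?_⟩, ?_⟩
  · ext1 f
    change s (rightRegular k G a f.1) = s f.1
    rw [hs, hs]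
    have hf (g : G) : f.1 (x * g) = f.1 g := by
      simpa using congrFun (mem_eigenRep.1 f.2.1) g
    rw [sum_weight_mul_eq (τ' := fun g => (τ (g * a⁻¹) : k)) (by rw [← hx, pow_orderOf_eq_one])
      hτk (fun g => by simpa [mul_assoc] using hτk (g * a⁻¹)) hf]
    rw [← Equiv.sum_comp (Equiv.mulRight a) (fun g => (τ (g * a⁻¹) : k) * f.1 g)]
    simp
  · ext1
    refine Representation.IntertwiningMap.ext ?_
    ext
    change s (fun _ => 1) = 1
    rw [hs]
    simp only [mul_one]
    rw [← Nat.cast_sum, inv_mul_cancel₀ hm]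

theorem isZero_trivial_of_frobenius [CharP k 5] [Fintype G] {x φ : G} (hx : orderOf x = 25)
    (hφ : φ ^ 4 = 1) (hxφ : x * φ = φ * x ^ 7) (hG : ¬ 125 ∣ Fintype.card G) {i : ℕ}
    (hi : 1 ≤ i) (hi' : i ≤ 3) : IsZero (groupCohomology (Rep.trivial k G k) i) := by
  have h5 : (5 : k) = 0 := mod_cast CharP.cast_eq_zero k 5
  have h5' : (5 : Module.End k (G → k)) = 0 := by
    have := map_ofNat (algebraMap k (Module.End k (G → k))) 5
    rw [← this]; simp [h5]
  set X := leftTranslate k x with hXdef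
  have hX : X ^ 25 = 1 := by
    rw [hXdef, ← leftTranslate_pow, ← hx, pow_orderOf_eq_one, leftTranslate_one]
  have hΦX : leftTranslate k φ * X = X ^ 7 * leftTranslate k φ := by
    rw [hXdef, ← leftTranslate_pow, ← leftTranslate_mul, ← leftTranslate_mul, hxφ]
  have hXmem : X ∈ rightCommutant k G := leftTranslate_mem_rightCommutant x
  have hu : kummer X ∈ rightCommutant k G := by
    have hn (n : ℕ) [n.AtLeastTwo] : (OfNat.ofNat n : Module.End k (G → k)) ∈ rightCommutant k G :=
      ofNat_mem _ n
    exact add_mem (add_mem (add_mem hXmem (mul_mem (hn 3) (pow_mem hXmem 7)))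
      (mul_mem (hn 4) (pow_mem hXmem 24))) (mul_mem (hn 2) (pow_mem hXmem 18))
  have hN : normElt X ∈ rightCommutant k G := sum_mem fun i _ => pow_mem hXmem i
  have hΦu : leftTranslate k φ * kummer X = (2 : k) • (kummer X * leftTranslate k φ) := by
    rw [mul_kummer h5' hX hΦX, Algebra.smul_def, map_ofNat]
  have hΦN : leftTranslate k φ * normElt X = (1 : k) • (normElt X * leftTranslate k φ) := by
    rw [one_smul]
    exact mul_normElt hX hΦX
  obtain ⟨τ, hτ⟩ := exists_orbit_sum_eq_one hx
  let θ : Module.End k (G → k) := LinearMap.mulLeft k (fun g => (τ g : k))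
  have hθ : ∑ i ∈ Finset.range 25, X ^ i * θ * X ^ (25 - i) = 1 := by
    refine LinearMap.ext fun f => funext fun g => ?_
    have hg : ∑ i ∈ Finset.range 25, (τ (x ^ i * g) : k) = 1 := by
      rw [← Nat.cast_sum, hτ, Nat.cast_one]
    rw [LinearMap.sum_apply, Finset.sum_apply, Module.End.one_apply, ← one_mul (f g), ← hg,
      Finset.sum_mul]
    refine Finset.sum_congr rfl fun i hi => ?_
    have hi25 : x ^ (25 - i) * x ^ i = 1 := by
      rw [← pow_add, Nat.sub_add_cancel (Finset.mem_range.1 hi).le, ← hx, pow_orderOf_eq_one]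
    rw [hXdef, ← leftTranslate_pow, ← leftTranslate_pow]
    simp [θ, ← mul_assoc, hi25]
  have h24 : (2 : k) ^ 4 = 1 := by linear_combination 3 * h5
  have h21 : (2 : k) ≠ 1 := fun h => one_ne_zero (α := k) (by linear_combination h)
  have h41 : (4 : k) ≠ 1 := fun h => one_ne_zero (α := k) (by linear_combination 2 * h - h5)
  let d₀ := eigenMap (φ := φ) (c := 1) (c' := 2) (kummer X) hu hΦu (by norm_num)
  let d₁ := eigenMap (φ := φ) (c := 2) (c' := 2) (d := 1) (normElt X) hN hΦN (one_mul 2).symm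
  let d₂ := eigenMap (φ := φ) (c := 2) (c' := 4) (kummer X) hu hΦu (by norm_num)
  let S₁ := ShortComplex.mk d₀ d₁ (eigenMap_comp_eq_zero (normElt_mul_kummer h5' hX))
  let S₂ := ShortComplex.mk d₁ d₂ (eigenMap_comp_eq_zero (kummer_mul_normElt h5' hX))
  have hS₁ : S₁.Exact := eigenMap_exact hφ (one_pow 4) h24 (normElt_mul_kummer h5' hX) fun f hf =>
    exists_kummer_apply_eq hX hθ hf
  have hex (f : G → k) (hf : kummer X f = 0) : ∃ f', normElt X f' = f := by
    have h := normElt_apply_of_fixed hθ (fixed_of_kummer_apply_eq_zero hX hf)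
    exact ⟨_, h⟩
  have hS₂ : S₂.Exact := eigenMap_exact hφ h24 (one_pow 4) (kummer_mul_normElt h5' hX) hex
  let K := Rep.of (eigenRep (k := k) x 1 ⊓ eigenRep φ 1).toRepresentation
  have hle : (eigenRep (k := k) x 1 ⊓ eigenRep φ 1).toSubmodule ≤ (eigenRep φ 1).toSubmodule :=
    inf_le_right
  let ε : K ⟶ Rep.of (eigenRep φ (1 : k)).toRepresentation :=
    Rep.ofHom ⟨Submodule.inclusion hle, fun g => rfl⟩
  have hε : Mono ε := (Rep.mono_iff_injective _).2 (Submodule.inclusion_injective hle)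
  have hεd : ε ≫ d₀ = 0 := by
    ext1
    refine Representation.IntertwiningMap.ext ?_
    ext1 f
    have hf : X f.1 = f.1 := (mem_eigenRep.1 f.2.1).trans (one_smul _ _)
    have hm : kummer X * normElt X = 0 := kummer_mul_normElt h5' hX
    have hfix := normElt_apply_of_fixed hθ hf
    have h : kummer X f.1 = 0 := by
      rw [← hfix, ← Module.End.mul_apply, hm, LinearMap.zero_apply]
    exact Subtype.ext h
  have hS₀ : (ShortComplex.mk ε d₀ hεd).Exact := exact_of_function_exact _ _ _ fun f hf =>
    ⟨⟨f.1, mem_eigenRep.2 ((fixed_of_kummer_apply_eq_zero hX congr(($hf).1)).trans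
      (one_smul _ _).symm), f.2⟩, rfl⟩
  have hac (c : k) (hc : c ^ 4 = 1) (n : ℕ) := isZero_eigenRep hφ hc n
  have hI₁ : Mono (imageComplex S₁).f := inferInstanceAs (Mono (image.ι _))
  have hI₂ : Mono (imageComplex S₂).f := inferInstanceAs (Mono (image.ι _))
  have z₀ : IsZero (groupCohomology (image d₀) 0) :=
    isZero_zero_of_mono (image.ι d₀) (isZero_zero_eigenRep h21)
  have z₁ : IsZero (groupCohomology (image d₁) 0) :=
    isZero_zero_of_mono (image.ι d₁) (isZero_zero_eigenRep h21)
  have z₂ : IsZero (groupCohomology (image d₂) 0) :=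
    isZero_zero_of_mono (image.ι d₂) (isZero_zero_eigenRep h41)
  have step₀ (n : ℕ) (h : IsZero (groupCohomology (image d₀) n)) :
      IsZero (groupCohomology K (n + 1)) :=
    isZero_succ_of_exact hS₀ n (hac 1 (one_pow 4) n) h
  have step₁ (n : ℕ) (h : IsZero (groupCohomology (image d₁) n)) :
      IsZero (groupCohomology (image d₀) (n + 1)) :=
    isZero_succ_of_exact (imageComplex_exact hS₁) n (hac 2 h24 n) h
  have step₂ (n : ℕ) (h : IsZero (groupCohomology (image d₂) n)) :
      IsZero (groupCohomology (image d₁) (n + 1)) :=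
    isZero_succ_of_exact (imageComplex_exact hS₂) n (hac 2 h24 n) h
  obtain ⟨ι, r, hιr⟩ := exists_retract_trivial (k := k) hx φ hG
  refine isZero_of_retract ι r hιr i ?_
  obtain rfl | rfl | rfl : i = 1 ∨ i = 2 ∨ i = 3 := by lia
  · exact step₀ 0 z₀
  · exact step₀ 1 (step₁ 0 z₁)
  · exact step₀ 2 (step₁ 1 (step₂ 0 z₂))

end groupCohomology

end Vanishing

namespace Matrix.GeneralLinearGroup

/-- The companion matrix of an element of order `25` in the multiplicative group of a field with
`7 ^ 4` elements. -/
def singer : GL (Fin 4) (ZMod 7) where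
  val := !![0, 0, 0, 6; 1, 0, 0, 1; 0, 1, 0, 2; 0, 0, 1, 1]
  inv := !![1, 1, 0, 0; 2, 0, 1, 0; 1, 0, 0, 1; 6, 0, 0, 0]
  val_inv := by decide
  inv_val := by decide

lemma singer_pow_five : (singer ^ 5).val = !![6, 4, 1, 2; 0, 2, 3, 6; 3, 6, 0, 6; 3, 6, 5, 5] := by
  rw [Units.val_pow_eq_pow_val]
  decide

lemma orderOf_singer : orderOf singer = 25 := by
  have : Fact (Nat.Prime 5) := ⟨by norm_num⟩
  refine orderOf_eq_prime_pow (p := 5) (n := 1) (fun h => ?_) (Units.ext ?_)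
  · have := congr($(congr(($h).val)) 0 0)
    rw [pow_one, singer_pow_five] at this
    revert this
    decide
  · rw [pow_succ, pow_one, pow_mul, Units.val_pow_eq_pow_val, singer_pow_five]
    decide

/-- The matrix of the inverse of the Frobenius map on a field with `7 ^ 4` elements. -/
def frobenius : GL (Fin 4) (ZMod 7) where
  val := !![1, 6, 1, 6; 0, 1, 2, 1; 0, 6, 4, 2; 0, 3, 0, 1]
  inv := !![1, 1, 1, 5; 0, 3, 2, 0; 0, 0, 2, 3; 0, 5, 1, 1]
  val_inv := by decide
  inv_val := by decide

lemma frobenius_pow_four : frobenius ^ 4 = 1 := by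
  refine Units.ext ?_
  rw [Units.val_pow_eq_pow_val]
  decide

lemma singer_mul_frobenius : singer * frobenius = frobenius * singer ^ 7 := by
  refine Units.ext ?_
  rw [pow_add singer 5 2, Units.val_mul, Units.val_mul, Units.val_mul, singer_pow_five,
    Units.val_pow_eq_pow_val]
  decide

lemma not_dvd_card_four_zmod_seven : ¬ 125 ∣ Nat.card (GL (Fin 4) (ZMod 7)) := by
  have : Fact (Nat.Prime 7) := ⟨by norm_num⟩
  rw [Matrix.card_GL_field]
  simp [Fin.prod_univ_four]

end Matrix.GeneralLinearGroup

/-- for `G = GL₄(F₇)` and `k` an algebraically closed field of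
characteristic `5`, the group cohomology `Hⁱ(G, k)` with trivial coefficients
vanishes for `1 ≤ i ≤ 3`. -/
theorem groupCohomology_GL4_F7_eq_zero
    (k : Type) [Field k] [IsAlgClosed k] (hk : ringChar k = 5) :
    ∀ i : ℕ, 1 ≤ i → i ≤ 3 →
      Subsingleton (groupCohomology (Rep.trivial k (GL (Fin 4) (ZMod 7)) k) i) := by
  intro i hi hi'
  have : CharP k 5 := ringChar.of_eq hk
  refine ModuleCat.subsingleton_of_isZero ?_
  refine groupCohomology.isZero_trivial_of_frobenius
    Matrix.GeneralLinearGroup.orderOf_singer Matrix.GeneralLinearGroup.frobenius_pow_four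
    Matrix.GeneralLinearGroup.singer_mul_frobenius ?_ hi hi'
  rw [← Nat.card_eq_fintype_card]
  exact Matrix.GeneralLinearGroup.not_dvd_card_four_zmod_seven
end
end

section
/- Let G = GL_6(F_3) be the group of invertible 6×6 matrices over the field with 3 elements, and let k be an algebraically closed field of characteristic 13. Then H^i(G, k) = 0 for i = 1, 2, i.e., Ext^i_{kG}(k, k) = 0 for 1 ≤ i ≤ 2. -/
noncomputable section

/-- If a set of pairwise commuting elements is killed by `p`, so is the subgroup it generates. -/
theorem Subgroup.closure_pow_eq_one {G : Type*} [Group G] {S : Set G} {p : ℕ}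
    (hcomm : ∀ x ∈ S, ∀ y ∈ S, x * y = y * x) (hpow : ∀ x ∈ S, x ^ p = 1)
    (x : Subgroup.closure S) : x ^ p = 1 := by
  have := Subgroup.isMulCommutative_closure hcomm
  suffices ∀ y (hy : y ∈ Subgroup.closure S), (⟨y, hy⟩ : Subgroup.closure S) ^ p = 1 from
    this x.1 x.2
  intro y hy
  induction hy using Subgroup.closure_induction with
  | mem y hy => exact Subtype.ext (hpow y hy)
  | one => exact one_pow p
  | mul y z hy hz ihy ihz =>
    have hyz : Commute (⟨y, hy⟩ : Subgroup.closure S) ⟨z, hz⟩ := mul_comm' _ _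
    simpa [ihy, ihz] using hyz.mul_pow p
  | inv y hy ih =>
    have := inv_pow (⟨y, hy⟩ : Subgroup.closure S) p
    rw [ih, inv_one] at this
    exact this

/-- An injection between abelian groups of prime exponent has a left inverse. -/
theorem MonoidHom.exists_leftInverse_of_pow_prime_eq_one {N Q : Type*} [CommGroup N] [CommGroup Q]
    {p : ℕ} [Fact p.Prime] (hN : ∀ a : N, a ^ p = 1) (hQ : ∀ q : Q, q ^ p = 1)
    (i : N →* Q) (hi : Function.Injective i) : ∃ r : Q →* N, ∀ a, r (i a) = a := by
  let _ : Module (ZMod p) (Additive N) := AddCommGroup.zmodModule hN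
  let _ : Module (ZMod p) (Additive Q) := AddCommGroup.zmodModule hQ
  obtain ⟨r, hr⟩ := LinearMap.exists_leftInverse_of_injective
    (AddMonoidHom.toZModLinearMap p (MonoidHom.toAdditive i)) (LinearMap.ker_eq_bot.2 hi)
  exact ⟨MonoidHom.toAdditive.symm r.toAddMonoidHom, fun a => LinearMap.congr_fun hr a⟩

theorem eq_one_of_eq_pow_succ {M : Type*} [Group M] {p t : ℕ} (htp : t.Coprime p) {a : M}
    (hp : a ^ p = 1) (ha : a = a ^ (t + 1)) : a = 1 := by
  have ht : a ^ t = 1 := by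
    rw [pow_succ] at ha
    exact mul_eq_right.1 ha.symm
  simpa [htp.gcd_eq_one] using pow_gcd_eq_one.2 ⟨ht, hp⟩

/-- Two commuting elements `x₁`, `x₂` of order `p`, each conjugate to its `(t + 1)`-st power, where
the first conjugation can be chosen to fix `x₂`. -/
structure IsTwistedPair {G : Type*} [Group G] (p t : ℕ) (x₁ x₂ s₁ s₂ : G) : Prop where
  comm : Commute x₁ x₂
  comm_conj : Commute s₁ x₂
  conj₁ : s₁ * x₁ * s₁⁻¹ = x₁ ^ (t + 1)
  conj₂ : s₂ * x₂ * s₂⁻¹ = x₂ ^ (t + 1)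
  pow₁ : x₁ ^ p = 1
  pow₂ : x₂ ^ p = 1
  ne_one₁ : x₁ ≠ 1
  ne_one₂ : x₂ ≠ 1

namespace IsTwistedPair

variable {G : Type*} [Group G] {p t : ℕ} {x₁ x₂ s₁ s₂ : G}

theorem notMem_zpowers (h : IsTwistedPair p t x₁ x₂ s₁ s₂) (htp : t.Coprime p) :
    x₂ ∉ Subgroup.zpowers x₁ := by
  rintro ⟨j, hj : x₁ ^ j = x₂⟩
  refine h.ne_one₂ (eq_one_of_eq_pow_succ htp h.pow₂ ?_)
  calc x₂ = s₁ * x₂ * s₁⁻¹ := by rw [h.comm_conj.eq, mul_inv_cancel_right]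
    _ = x₂ ^ (t + 1) := by
      rw [← hj, ← conj_zpow, h.conj₁, ← zpow_natCast, ← zpow_natCast, zpow_comm]

theorem pairwise_comm (h : IsTwistedPair p t x₁ x₂ s₁ s₂) :
    ∀ x ∈ ({x₁, x₂} : Set G), ∀ y ∈ ({x₁, x₂} : Set G), x * y = y * x := by
  rintro x (rfl | rfl) y (rfl | rfl)
  exacts [rfl, h.comm.eq, h.comm.eq.symm, rfl]

/-- A twisted pair generates a subgroup of order `p ^ 2`. -/
theorem not_dvd_index_closure [Finite G] [hp : Fact p.Prime]
    (h : IsTwistedPair p t x₁ x₂ s₁ s₂) (htp : t.Coprime p) (hG : ¬ p ^ 3 ∣ Nat.card G) :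
    ¬ p ∣ (Subgroup.closure {x₁, x₂}).index := by
  intro hdvd
  have hpow : ∀ x ∈ ({x₁, x₂} : Set G), x ^ p = 1 := by
    rintro x (rfl | rfl)
    exacts [h.pow₁, h.pow₂]
  have hP : IsPGroup p (Subgroup.closure {x₁, x₂}) := fun x =>
    ⟨1, by rw [pow_one]; exact Subgroup.closure_pow_eq_one h.pairwise_comm hpow x⟩
  obtain ⟨n, hn⟩ := IsPGroup.iff_card.1 hP
  have hle : Subgroup.zpowers x₁ ≤ Subgroup.closure {x₁, x₂} :=
    Subgroup.zpowers_le.2 (Subgroup.subset_closure (by simp))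
  have h2 : 2 ≤ n := by
    by_contra! hlt
    have hcard : Nat.card (Subgroup.closure {x₁, x₂}) ≤ Nat.card (Subgroup.zpowers x₁) := by
      rw [hn, Nat.card_zpowers, orderOf_eq_prime h.pow₁ h.ne_one₁]
      simpa using Nat.pow_le_pow_right hp.out.pos (Nat.le_of_lt_succ hlt)
    refine h.notMem_zpowers htp ?_
    rw [Subgroup.eq_of_le_of_card_ge hle hcard]
    exact Subgroup.subset_closure (by simp)
  refine hG ?_
  rw [← Subgroup.card_mul_index (Subgroup.closure {x₁, x₂}), hn, pow_succ]
  exact mul_dvd_mul (pow_dvd_pow p h2) hdvd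

section Extension

variable {N E : Type*} [CommGroup N] [Group E] {i : N →* E} {π : E →* G}

/-- Lifts of a twisted pair to a central extension by a group of exponent `p` commute. -/
theorem commute_lift (h : IsTwistedPair p t x₁ x₂ s₁ s₂) (htp : t.Coprime p)
    (hN : ∀ a : N, a ^ p = 1) (hcentral : ∀ a e, Commute (i a) e) (hrange : i.range = π.ker)
    (hπ : Function.Surjective π) {y₁ y₂ : E} (h₁ : π y₁ = x₁) (h₂ : π y₂ = x₂) :
    Commute y₁ y₂ := by
  have lift : ∀ e e' : E, π e = π e' → ∃ a, e = i a * e' := by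
    intro e e' hee
    have : e * e'⁻¹ ∈ i.range := by rw [hrange, MonoidHom.mem_ker]; simp [hee]
    obtain ⟨a, ha⟩ := this
    exact ⟨a, by rw [ha]; simp⟩
  obtain ⟨s, hs⟩ := hπ s₁
  obtain ⟨c, hc⟩ := lift (y₁ * y₂) (y₂ * y₁) (by simp [h₁, h₂, h.comm.eq])
  obtain ⟨z, hz⟩ := lift (s * y₁ * s⁻¹) (y₁ ^ (t + 1)) (by simp [h₁, hs, h.conj₁])
  obtain ⟨w, hw⟩ := lift (s * y₂ * s⁻¹) y₂ (by simp [h₂, hs, h.comm_conj.eq])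
  have hpow : ∀ n : ℕ, y₁ ^ n * y₂ = i c ^ n * (y₂ * y₁ ^ n) := by
    intro n
    induction n with
    | zero => simp
    | succ n ih =>
      calc y₁ ^ (n + 1) * y₂ = y₁ ^ n * (y₁ * y₂) := by rw [pow_succ, mul_assoc]
        _ = i c * (y₁ ^ n * y₂ * y₁) := by
          rw [hc, ← mul_assoc, ← (hcentral c (y₁ ^ n)).eq]; simp only [mul_assoc]
        _ = i c ^ (n + 1) * (y₂ * y₁ ^ (n + 1)) := by
          rw [ih, pow_succ', pow_succ]; simp only [mul_assoc]
  have hconj : y₁ ^ (t + 1) * y₂ = i c * (y₂ * y₁ ^ (t + 1)) := by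
    have e₁ : (s * y₁ * s⁻¹) * (s * y₂ * s⁻¹) =
        i c * ((s * y₂ * s⁻¹) * (s * y₁ * s⁻¹)) := by
      calc (s * y₁ * s⁻¹) * (s * y₂ * s⁻¹) = s * (y₁ * y₂) * s⁻¹ := by group
        _ = i c * (s * (y₂ * y₁) * s⁻¹) := by
          rw [hc, ← mul_assoc, ← (hcentral c s).eq]; simp only [mul_assoc]
        _ = _ := by group
    rw [hz, hw] at e₁
    have e₂ : i z * y₁ ^ (t + 1) * (i w * y₂) = i z * i w * (y₁ ^ (t + 1) * y₂) := by
      rw [mul_assoc, ← mul_assoc _ (i w), ← (hcentral w (y₁ ^ (t + 1))).eq]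
      simp only [mul_assoc]
    have e₃ : i c * (i w * y₂ * (i z * y₁ ^ (t + 1))) =
        i z * i w * (i c * (y₂ * y₁ ^ (t + 1))) := by
      rw [mul_assoc (i w), ← mul_assoc y₂, ← (hcentral z y₂).eq, ← mul_assoc (i z * i w),
        ← map_mul, ← map_mul, mul_comm (z * w) c, mul_comm z w]
      simp only [map_mul, mul_assoc]
    rw [e₂, e₃] at e₁
    exact mul_left_cancel e₁
  have hic : i c = 1 := by
    refine eq_one_of_eq_pow_succ htp (by rw [← map_pow, hN, map_one]) ?_
    exact mul_right_cancel (hconj.symm.trans (hpow (t + 1)))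
  rw [hic, one_mul] at hc
  exact hc

/-- In a central extension by a group of exponent `p`, lifts of an element of order `p` conjugate
to its `(t + 1)`-st power have order `p`. -/
theorem _root_.pow_lift_eq_one_of_conj_eq_pow (htp : t.Coprime p)
    (hN : ∀ a : N, a ^ p = 1) (hcentral : ∀ a e, Commute (i a) e) (hrange : i.range = π.ker)
    (hπ : Function.Surjective π) {x s : G} (hx : x ^ p = 1) (hs : s * x * s⁻¹ = x ^ (t + 1))
    {y : E} (hy : π y = x) : y ^ p = 1 := by
  obtain ⟨u, hu⟩ := hπ s
  obtain ⟨a, ha⟩ : y ^ p ∈ i.range := by rw [hrange, MonoidHom.mem_ker, map_pow, hy, hx]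
  obtain ⟨z, hz⟩ : u * y * u⁻¹ * (y ^ (t + 1))⁻¹ ∈ i.range := by
    rw [hrange, MonoidHom.mem_ker]; simp [hy, hu, hs]
  refine eq_one_of_eq_pow_succ htp (by rw [← ha, ← map_pow, hN, map_one]) ?_
  calc y ^ p = u * y ^ p * u⁻¹ := by rw [← ha, ← (hcentral a u).eq, mul_inv_cancel_right]
    _ = (i z * y ^ (t + 1)) ^ p := by rw [← conj_pow, hz, inv_mul_cancel_right]
    _ = (y ^ p) ^ (t + 1) := by
      rw [(hcentral z _).mul_pow, ← map_pow, hN, map_one, one_mul, ← pow_mul, ← pow_mul, mul_comm]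

/-- A central extension of `G` by a group of exponent `p` splits if `G` has a twisted pair and its
order is not divisible by `p ^ 3`. -/
theorem exists_retraction [Finite G] [hp : Fact p.Prime]
    (h : IsTwistedPair p t x₁ x₂ s₁ s₂) (htp : t.Coprime p) (hG : ¬ p ^ 3 ∣ Nat.card G)
    (hN : ∀ a : N, a ^ p = 1) (hi : Function.Injective i) (hcentral : ∀ a e, Commute (i a) e)
    (hrange : i.range = π.ker) (hπ : Function.Surjective π) :
    ∃ V : E →* N, ∀ a, V (i a) = a := by
  obtain ⟨y₁, h₁⟩ := hπ x₁
  obtain ⟨y₂, h₂⟩ := hπ x₂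
  have hy := h.commute_lift htp hN hcentral hrange hπ h₁ h₂
  let S : Set E := Set.range i ∪ {y₁, y₂}
  have hS : ∀ x ∈ S, ∀ y ∈ S, x * y = y * x := by
    rintro x (⟨a, rfl⟩ | rfl | rfl) y (⟨b, rfl⟩ | rfl | rfl)
    exacts [(hcentral _ _).eq, (hcentral _ _).eq, (hcentral _ _).eq, (hcentral _ _).eq.symm, rfl,
      hy.eq, (hcentral _ _).eq.symm, hy.eq.symm, rfl]
  have hSp : ∀ x ∈ S, x ^ p = 1 := by
    rintro x (⟨a, rfl⟩ | rfl | rfl)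
    · rw [← map_pow, hN, map_one]
    · exact pow_lift_eq_one_of_conj_eq_pow htp hN hcentral hrange hπ h.pow₁ h.conj₁ h₁
    · exact pow_lift_eq_one_of_conj_eq_pow htp hN hcentral hrange hπ h.pow₂ h.conj₂ h₂
  let Q := Subgroup.closure S
  have hiQ : ∀ a, i a ∈ Q := fun a => Subgroup.subset_closure (Or.inl ⟨a, rfl⟩)
  have hker : π.ker ≤ Q := by
    rw [← hrange]
    rintro _ ⟨a, rfl⟩
    exact hiQ a
  have hindex : ¬ p ∣ Q.index := by
    intro hdvd
    refine h.not_dvd_index_closure htp hG (hdvd.trans ?_)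
    rw [← Subgroup.index_map_eq Q hπ hker]
    refine Subgroup.index_dvd_of_le ((Subgroup.closure_le _).2 ?_)
    rintro x (rfl | rfl)
    exacts [⟨y₁, Subgroup.subset_closure (by simp [S]), h₁⟩,
      ⟨y₂, Subgroup.subset_closure (by simp [S]), h₂⟩]
  have hfin : Q.FiniteIndex := ⟨fun h0 => hindex (h0 ▸ dvd_zero p)⟩
  let _ : CommGroup Q :=
    { (inferInstance : Group Q) with
      mul_comm := (Subgroup.isMulCommutative_closure hS).is_comm.comm }
  obtain ⟨r, hr⟩ := MonoidHom.exists_leftInverse_of_pow_prime_eq_one hN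
    (Subgroup.closure_pow_eq_one hS hSp) (i.codRestrict Q hiQ)
    (fun a b hab => hi (congrArg Subtype.val hab))
  obtain ⟨m, -, hm⟩ := Nat.exists_mul_mod_eq_one_of_coprime
    ((hp.out.coprime_iff_not_dvd.2 hindex).symm) hp.out.one_lt
  refine ⟨(powMonoidHom m).comp (MonoidHom.transfer r), fun a => ?_⟩
  have htransfer : MonoidHom.transfer r (i a) = a ^ Q.index := by
    rw [MonoidHom.transfer_eq_pow r (i a) fun n g _ => by
      rw [mul_assoc, ((hcentral a g).pow_left n).eq, inv_mul_cancel_left]]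
    rw [← hr (a ^ Q.index)]
    exact congrArg r (Subtype.ext (map_pow i a _).symm)
  rw [MonoidHom.comp_apply, htransfer, powMonoidHom_apply, ← pow_mul,
    pow_eq_pow_mod _ (hN a), hm, pow_one]

end Extension

end IsTwistedPair

namespace groupCohomology

universe u

variable {k G : Type u} [CommRing k] [Group G]

/-- The extension of `G` by the additive group of `k` attached to a `2`-cocycle. -/
@[ext]
structure CocycleExtension (f : cocycles₂ (Rep.trivial k G k)) where
  /-- The coordinate in the kernel. -/
  fst : k
  /-- The coordinate in the quotient. -/
  snd : G

namespace CocycleExtension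

/-- The underlying function of a `2`-cocycle with trivial coefficients. -/
def cocycleFun (f : cocycles₂ (Rep.trivial k G k)) (g h : G) : k := f.1 (g, h)

theorem cocycleFun_assoc (f : cocycles₂ (Rep.trivial k G k)) (g h j : G) :
    cocycleFun f (g * h) j + cocycleFun f g h = cocycleFun f h j + cocycleFun f g (h * j) :=
  (mem_cocycles₂_iff f.1).1 f.2 g h j

theorem cocycleFun_one_left (f : cocycles₂ (Rep.trivial k G k)) (g : G) :
    cocycleFun f 1 g = cocycleFun f 1 1 := by
  simpa using (cocycleFun_assoc f 1 1 g).symm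

theorem cocycleFun_one_right (f : cocycles₂ (Rep.trivial k G k)) (g : G) :
    cocycleFun f g 1 = cocycleFun f 1 1 := by
  simpa using cocycleFun_assoc f g 1 1

variable {f : cocycles₂ (Rep.trivial k G k)}

instance : Mul (CocycleExtension f) :=
  ⟨fun x y => ⟨x.fst + y.fst + cocycleFun f x.snd y.snd, x.snd * y.snd⟩⟩

instance : One (CocycleExtension f) := ⟨⟨-cocycleFun f 1 1, 1⟩⟩

instance : Inv (CocycleExtension f) :=
  ⟨fun x => ⟨-x.fst - cocycleFun f x.snd⁻¹ x.snd - cocycleFun f 1 1, x.snd⁻¹⟩⟩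

theorem mul_def (x y : CocycleExtension f) :
    x * y = ⟨x.fst + y.fst + cocycleFun f x.snd y.snd, x.snd * y.snd⟩ := rfl

theorem one_def : (1 : CocycleExtension f) = ⟨-cocycleFun f 1 1, 1⟩ := rfl

theorem inv_def (x : CocycleExtension f) :
    x⁻¹ = ⟨-x.fst - cocycleFun f x.snd⁻¹ x.snd - cocycleFun f 1 1, x.snd⁻¹⟩ := rfl

instance : Group (CocycleExtension f) :=
  Group.ofLeftAxioms
    (fun x y z => by
      ext
      · simp only [mul_def]
        linear_combination cocycleFun_assoc f x.snd y.snd z.snd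
      · simp only [mul_def, mul_assoc])
    (fun x => by
      ext
      · simp only [mul_def, one_def, cocycleFun_one_left f x.snd]
        ring
      · simp only [mul_def, one_def, one_mul])
    (fun x => by
      ext
      · simp only [mul_def, one_def, inv_def]
        ring
      · simp only [mul_def, one_def, inv_def, inv_mul_cancel])

variable (f)

/-- The inclusion of the kernel. -/
def inl : Multiplicative k →* CocycleExtension f where
  toFun a := ⟨a.toAdd - cocycleFun f 1 1, 1⟩
  map_one' := by simp [one_def]
  map_mul' a b := by
    ext
    · simp only [mul_def, toAdd_mul]
      ring
    · simp [mul_def]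

/-- The projection onto the quotient. -/
def proj : CocycleExtension f →* G where
  toFun := snd
  map_one' := rfl
  map_mul' _ _ := rfl

variable {f}

theorem inl_apply (a : Multiplicative k) : inl f a = ⟨a.toAdd - cocycleFun f 1 1, 1⟩ := rfl

theorem proj_apply (x : CocycleExtension f) : proj f x = x.snd := rfl

theorem inl_injective : Function.Injective (inl f) := fun _ _ hab =>
  Multiplicative.toAdd.injective (sub_left_injective (congrArg fst hab))

theorem proj_surjective : Function.Surjective (proj f) := fun g => ⟨⟨0, g⟩, rfl⟩

theorem range_inl : (inl f).range = (proj f).ker := by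
  ext x
  constructor
  · rintro ⟨a, rfl⟩
    rfl
  · intro hx
    refine ⟨Multiplicative.ofAdd (x.fst + cocycleFun f 1 1), ?_⟩
    ext
    · simp [inl_apply]
    · exact (MonoidHom.mem_ker.1 hx).symm

theorem commute_inl (a : Multiplicative k) (x : CocycleExtension f) : Commute (inl f a) x := by
  ext
  · simp only [mul_def, inl_apply, cocycleFun_one_left f x.snd, cocycleFun_one_right f x.snd]
    ring
  · simp [mul_def, inl_apply]

/-- A cocycle whose extension retracts onto the kernel is a coboundary. -/
theorem mem_coboundaries₂_of_retraction (V : CocycleExtension f →* Multiplicative k)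
    (hV : ∀ a, V (inl f a) = a) : f.1 ∈ coboundaries₂ (Rep.trivial k G k) := by
  let v : G → k := fun g => (V ⟨0, g⟩).toAdd
  have key : ∀ g h, v g + v h = cocycleFun f g h + v (g * h) := by
    intro g h
    have hmul : (⟨0, g⟩ * ⟨0, h⟩ : CocycleExtension f) =
        inl f (Multiplicative.ofAdd (cocycleFun f g h)) * ⟨0, g * h⟩ := by
      ext
      · simp only [mul_def, inl_apply, cocycleFun_one_left f (g * h), toAdd_ofAdd]
        ring
      · simp [mul_def, inl_apply]
    have := congrArg (fun x => (V x).toAdd) hmul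
    simpa only [map_mul, toAdd_mul, hV, toAdd_ofAdd] using this
  refine ⟨v, funext fun ⟨g, h⟩ => ?_⟩
  change v h - v (g * h) + v g = cocycleFun f g h
  linear_combination key g h

end CocycleExtension

end groupCohomology

namespace IsTwistedPair

open groupCohomology

universe u

variable {k G : Type u} [CommRing k] [Group G] [Finite G] {p t : ℕ} [hp : Fact p.Prime]
  {x₁ x₂ s₁ s₂ : G}

theorem monoidHom_eq_one {N : Type*} [CommGroup N] (h : IsTwistedPair p t x₁ x₂ s₁ s₂)
    (htp : t.Coprime p) (hG : ¬ p ^ 3 ∣ Nat.card G) (hN : ∀ a : N, a ^ p = 1) (φ : G →* N) :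
    φ = 1 := by
  have hconj : ∀ x s, s * x * s⁻¹ = x ^ (t + 1) → x ∈ φ.ker := fun x s hs =>
    eq_one_of_eq_pow_succ htp (hN _) (by
      rw [← map_pow, ← hs, map_mul, map_mul, map_inv, mul_right_comm, mul_inv_cancel, one_mul])
  have hle : Subgroup.closure {x₁, x₂} ≤ φ.ker := by
    rw [Subgroup.closure_le]
    rintro x (rfl | rfl)
    exacts [hconj _ _ h.conj₁, hconj _ _ h.conj₂]
  have hcop : Nat.Coprime φ.ker.index p :=
    (hp.out.coprime_iff_not_dvd.2 fun hdvd => h.not_dvd_index_closure htp hG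
      (hdvd.trans (Subgroup.index_dvd_of_le hle))).symm
  ext g
  have hg : φ g ^ φ.ker.index = 1 := by rw [← map_pow]; exact φ.ker.pow_index_mem g
  simpa [hcop.gcd_eq_one] using pow_gcd_eq_one.2 ⟨hg, hN (φ g)⟩

theorem subsingleton_H1 [CharP k p] (h : IsTwistedPair p t x₁ x₂ s₁ s₂) (htp : t.Coprime p)
    (hG : ¬ p ^ 3 ∣ Nat.card G) : Subsingleton (groupCohomology (Rep.trivial k G k) 1) := by
  refine subsingleton_of_forall_eq 0 fun x => ?_
  induction x using H1_induction_on with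
  | h f =>
    rw [H1π_eq_zero_iff]
    have hf : ∀ g, f.1 g = 0 := by
      let φ : G →* Multiplicative k := MonoidHom.mk' (fun g => Multiplicative.ofAdd (f.1 g))
        fun a b => by
          rw [(mem_cocycles₁_iff f.1).1 f.2 a b, add_comm]
          rfl
      exact fun g => DFunLike.congr_fun (h.monoidHom_eq_one htp hG (fun a : Multiplicative k =>
        show p • a.toAdd = 0 by simp) φ) g
    rw [show ⇑f = 0 from funext hf]
    exact zero_mem _

theorem subsingleton_H2 [CharP k p] (h : IsTwistedPair p t x₁ x₂ s₁ s₂) (htp : t.Coprime p)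
    (hG : ¬ p ^ 3 ∣ Nat.card G) : Subsingleton (groupCohomology (Rep.trivial k G k) 2) := by
  refine subsingleton_of_forall_eq 0 fun x => ?_
  induction x using H2_induction_on with
  | h f =>
    rw [H2π_eq_zero_iff]
    obtain ⟨V, hV⟩ := h.exists_retraction htp hG
      (fun a : Multiplicative k => show p • a.toAdd = 0 by simp)
      CocycleExtension.inl_injective CocycleExtension.commute_inl
      (CocycleExtension.range_inl (f := f)) CocycleExtension.proj_surjective
    exact CocycleExtension.mem_coboundaries₂_of_retraction V hV

end IsTwistedPair

/-- Multiplication by a root `x` of `X ^ 3 - X - 1` on `𝔽₂₇`, in the basis `1, x, x ^ 2`. -/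
def rootMatrix : Matrix (Fin 3) (Fin 3) (ZMod 3) := !![0, 0, 1; 1, 0, 1; 0, 1, 0]

theorem rootMatrix_pow_three : rootMatrix ^ 3 = rootMatrix + 1 := by
  rw [pow_three]; decide

theorem rootMatrix_pow_thirteen : rootMatrix ^ 13 = 1 := by
  have h9 : rootMatrix ^ 9 = rootMatrix + 1 + 1 := by
    rw [show 9 = 3 * 3 from rfl, pow_mul, rootMatrix_pow_three, pow_three]; decide
  rw [show 13 = 9 + 3 + 1 from rfl, pow_succ, pow_add, h9, rootMatrix_pow_three]; decide

/-- `rootMatrix` as an element of `GL₃(𝔽₃)`. -/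
def rootGL : GL (Fin 3) (ZMod 3) := Units.ofPowEqOne rootMatrix 13 rootMatrix_pow_thirteen (by simp)

/-- The Frobenius of `𝔽₂₇` in the basis `1, x, x ^ 2`, where `x ^ 3 = x + 1`. -/
def frobeniusGL : GL (Fin 3) (ZMod 3) where
  val := !![1, 1, 1; 0, 1, 2; 0, 0, 1]
  inv := !![1, 2, 1; 0, 1, 1; 0, 0, 1]
  val_inv := by decide
  inv_val := by decide

theorem frobeniusGL_conj : frobeniusGL * rootGL * frobeniusGL⁻¹ = rootGL ^ 3 := by
  rw [mul_inv_eq_iff_eq_mul]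
  ext : 1
  change frobeniusGL.val * rootMatrix = rootMatrix ^ 3 * frobeniusGL.val
  rw [rootMatrix_pow_three]
  decide

/-- The block diagonal embedding of `GL₃ × GL₃` in `GL₆`. -/
def blockGL : (Fin 2 → GL (Fin 3) (ZMod 3)) →* GL (Fin 6) (ZMod 3) :=
  (Units.map ((Matrix.reindexRingEquiv (ZMod 3) (finProdFinEquiv (m := 3) (n := 2))).toRingHom.comp
    (Matrix.blockDiagonalRingHom (Fin 3) (Fin 2) (ZMod 3))).toMonoidHom).comp
    MulEquiv.piUnits.symm.toMonoidHom

theorem blockGL_injective : Function.Injective blockGL := by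
  refine (Units.map_injective ?_).comp MulEquiv.piUnits.symm.injective
  exact (Matrix.reindexRingEquiv (ZMod 3) (finProdFinEquiv (m := 3) (n := 2))).injective.comp
    Matrix.blockDiagonal_injective

theorem isTwistedPair_blockGL : IsTwistedPair 13 2
    (blockGL (Pi.mulSingle 0 rootGL)) (blockGL (Pi.mulSingle 1 rootGL))
    (blockGL (Pi.mulSingle 0 frobeniusGL)) (blockGL (Pi.mulSingle 1 frobeniusGL)) := by
  have hpow : rootGL ^ 13 = 1 := Units.ext rootMatrix_pow_thirteen
  have hne : rootGL ≠ 1 := fun h =>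
    absurd (congrArg Units.val h : rootMatrix = 1) (by decide)
  have hne' : ∀ j : Fin 2, blockGL (Pi.mulSingle j rootGL) ≠ 1 := fun j hj =>
    hne (by simpa using blockGL_injective (hj.trans (map_one blockGL).symm))
  have hconj : ∀ j : Fin 2, blockGL (Pi.mulSingle j frobeniusGL) *
      blockGL (Pi.mulSingle j rootGL) * (blockGL (Pi.mulSingle j frobeniusGL))⁻¹ =
      blockGL (Pi.mulSingle j rootGL) ^ (2 + 1) := fun j => by
    rw [← map_inv, ← map_mul, ← map_mul, ← map_pow, ← Pi.mulSingle_inv, ← Pi.mulSingle_mul,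
      ← Pi.mulSingle_mul, ← Pi.mulSingle_pow, frobeniusGL_conj]
  have hpow' : ∀ j : Fin 2, blockGL (Pi.mulSingle j rootGL) ^ 13 = 1 := fun j => by
    rw [← map_pow, ← Pi.mulSingle_pow, hpow, Pi.mulSingle_one, map_one]
  exact
    { comm := (Pi.mulSingle_commute (by decide) _ _).map blockGL
      comm_conj := (Pi.mulSingle_commute (by decide) _ _).map blockGL
      conj₁ := hconj 0
      conj₂ := hconj 1
      pow₁ := hpow' 0
      pow₂ := hpow' 1
      ne_one₁ := hne' 0
      ne_one₂ := hne' 1 }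

theorem not_dvd_card_GL6_F3 : ¬ 13 ^ 3 ∣ Nat.card (GL (Fin 6) (ZMod 3)) := by
  rw [Matrix.card_GL_field, ZMod.card]
  decide

/-- for `G = GL₆(F₃)` and `k` an algebraically closed field of
characteristic `13`, the group cohomology `Hⁱ(G, k)` with trivial coefficients
vanishes for `1 ≤ i ≤ 2`. -/
theorem groupCohomology_GL6_F3_eq_zero
    (k : Type) [Field k] [IsAlgClosed k] (hk : ringChar k = 13) :
    ∀ i : ℕ, 1 ≤ i → i ≤ 2 →
      Subsingleton (groupCohomology (Rep.trivial k (GL (Fin 6) (ZMod 3)) k) i) := by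
  intro i h₁ h₂
  have : Fact (Nat.Prime 13) := ⟨by norm_num⟩
  have : CharP k 13 := ringChar.of_eq hk
  obtain rfl | rfl : i = 1 ∨ i = 2 := by lia
  · exact isTwistedPair_blockGL.subsingleton_H1 (by norm_num) not_dvd_card_GL6_F3
  · exact isTwistedPair_blockGL.subsingleton_H2 (by norm_num) not_dvd_card_GL6_F3
end
end

section
/- Let A be a ring and J a two-sided ideal of A, and let Y and V be left A/J-modules, regarded also as A-modules by restriction along the quotient map A → A/J. Suppose there is a short exact sequence 0 → L → P → Y → 0 of A/J-modules in which P is projective both as an A/J-module and as an A-module. Then Ext^1_A(Y, V) ≅ Ext^1_{A/J}(Y, V) as abelian groups. -/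
open CategoryTheory

noncomputable section

open Limits

universe v u u'

namespace CategoryTheory.ProjectiveResolution

variable {C : Type*} [Category* C] [Abelian C] {X : C} (Q : ProjectiveResolution X)

/-- The augmentation of a projective resolution, as a morphism to the resolved object. -/
def augmentation : Q.complex.X 0 ⟶ X := Q.π.f 0

lemma d_comp_augmentation : Q.complex.d 1 0 ≫ Q.augmentation = 0 :=
  Q.complex_d_comp_π_f_zero

lemma d_comp_augmentation_comp {Z : C} (h : X ⟶ Z) :
    Q.complex.d 1 0 ≫ Q.augmentation ≫ h = 0 := by
  rw [← Category.assoc, Q.d_comp_augmentation, zero_comp]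

lemma exact_augmentation :
    (ShortComplex.mk (Q.complex.d 1 0) Q.augmentation Q.d_comp_augmentation).Exact :=
  Q.exact₀

instance : Epi Q.augmentation := inferInstanceAs (Epi (Q.π.f 0))

lemma linearYoneda_map_augmentation_comp (R : Type*) [Ring R] [Linear R C] (V : C) :
    ((linearYoneda R C).obj V).map Q.augmentation.op ≫
      ((linearYoneda R C).obj V).map (Q.complex.d 1 0).op = 0 := by
  rw [← Functor.map_comp, ← op_comp, Q.d_comp_augmentation, op_zero, Functor.map_zero]

/-- Precomposition with the augmentation of a projective resolution identifies `X ⟶ V` with the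
degree-zero cocycles of the resolution with values in `V`. -/
lemma linearYoneda_exact (R : Type*) [Ring R] [Linear R C] (V : C) :
    (ShortComplex.mk _ _ (Q.linearYoneda_map_augmentation_comp R V)).Exact := by
  rw [ShortComplex.moduleCat_exact_iff]
  intro (φ : Q.complex.X 0 ⟶ V) (hφ : Q.complex.d 1 0 ≫ φ = 0)
  exact ⟨Q.exact_augmentation.desc φ hφ, Q.exact_augmentation.g_desc φ hφ⟩

end CategoryTheory.ProjectiveResolution

namespace CategoryTheory.ShortComplex.ShortExact

variable {C : Type*} [Category* C] [Abelian C] {S : ShortComplex C}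

/-- Splicing a projective resolution of `S.X₁` with a short exact sequence whose middle term
is projective gives a projective resolution of `S.X₃`. -/
def projectiveResolution (hS : S.ShortExact) (Q : ProjectiveResolution S.X₁)
    [hP : Projective S.X₂] : ProjectiveResolution S.X₃ where
  complex := Q.complex.augment (Q.augmentation ≫ S.f) (Q.d_comp_augmentation_comp S.f)
  projective
    | 0 => hP
    | n + 1 => Q.projective n
  π := (ChainComplex.toSingle₀Equiv _ _).symm ⟨S.g, by
    exact (Category.assoc Q.augmentation S.f S.g).trans
      ((congrArg (Q.augmentation ≫ ·) S.zero).trans comp_zero)⟩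
  quasiIso := ⟨fun n => by
    have := hS.epi_g
    have := hS.mono_f
    cases n with
    | zero =>
      rw [ChainComplex.quasiIsoAt₀_iff, ShortComplex.quasiIso_iff_of_zeros']
      · let α : ShortComplex.mk (Q.augmentation ≫ S.f) S.g
            (by rw [Category.assoc, S.zero, comp_zero]) ⟶ S :=
          { τ₁ := Q.augmentation
            τ₂ := 𝟙 _
            τ₃ := 𝟙 _ }
        have : Epi α.τ₁ := inferInstanceAs (Epi Q.augmentation)
        refine (ShortComplex.exact_and_epi_g_iff_of_iso ?_).2
          ⟨(ShortComplex.exact_iff_of_epi_of_isIso_of_mono α).2 hS.exact, hS.epi_g⟩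
        exact ShortComplex.isoMk (Iso.refl _) (Iso.refl _) (Iso.refl _)
          ((Category.id_comp _).trans (Category.comp_id _).symm)
          ((Category.id_comp S.g).trans (Eq.trans
            (ChainComplex.toSingle₀Equiv_symm_apply_f_zero
              (C := Q.complex.augment (Q.augmentation ≫ S.f) _) (X := S.X₃) S.g _).symm
            (Category.comp_id _).symm))
      all_goals rfl
    | succ n =>
      rw [quasiIsoAt_iff_exactAt' _ _ (ChainComplex.exactAt_succ_single_obj _ _),
        HomologicalComplex.exactAt_iff' _ (n + 1 + 1) (n + 1) n (by simp) (by simp)]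
      cases n with
      | zero =>
        let α : ShortComplex.mk (Q.complex.d 1 0) Q.augmentation Q.d_comp_augmentation ⟶
            ShortComplex.mk (Q.complex.d 1 0) (Q.augmentation ≫ S.f)
              (Q.d_comp_augmentation_comp S.f) :=
          { τ₁ := 𝟙 _
            τ₂ := 𝟙 _
            τ₃ := S.f }
        exact (ShortComplex.exact_iff_of_epi_of_isIso_of_mono α).1 Q.exact_augmentation
      | succ n => exact Q.exact_succ n⟩

variable (R : Type*) [Ring R] [Linear R C] [EnoughProjectives C]

/-- If `0 → S.X₁ → S.X₂ → S.X₃ → 0` is exact and `S.X₂` is projective, then `Ext¹(S.X₃, V)` is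
the cokernel of `Hom(S.X₂, V) → Hom(S.X₁, V)`. -/
def extOneIso (hS : S.ShortExact) [Projective S.X₂] (V : C) :
    ((Ext R C 1).obj (Opposite.op S.X₃)).obj V ≅
      cokernel (((linearYoneda R C).obj V).map S.f.op) := by
  let Q := CategoryTheory.projectiveResolution S.X₁
  let G := (linearYoneda R C).obj V
  have : Mono (G.map Q.augmentation.op) := by
    rw [ModuleCat.mono_iff_injective]
    intro (a : S.X₁ ⟶ V) (b : S.X₁ ⟶ V) (h : Q.augmentation ≫ a = Q.augmentation ≫ b)
    exact (cancel_epi _).1 h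
  let K := (hS.projectiveResolution Q).complex.linearYonedaObj R V
  let s : ShortComplex (ModuleCat R) :=
    ShortComplex.mk (G.map (Q.augmentation ≫ S.f).op) (G.map (Q.complex.d 1 0).op) (by
      rw [← Functor.map_comp, ← op_comp, Q.d_comp_augmentation_comp, op_zero,
        Functor.map_zero])
  let hi := (Q.linearYoneda_exact R V).fIsKernel
  have hf : hi.lift (KernelFork.ofι _ s.zero) = G.map S.f.op := by
    rw [← cancel_mono (G.map Q.augmentation.op)]
    exact (hi.fac _ WalkingParallelPair.zero).trans (G.map_comp S.f.op Q.augmentation.op)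
  let d : s.LeftHomologyData :=
    { K := G.obj (Opposite.op S.X₁)
      H := cokernel (G.map S.f.op)
      i := G.map Q.augmentation.op
      π := cokernel.π _
      wi := Q.linearYoneda_map_augmentation_comp R V
      hi := hi
      wπ := by rw [hf, cokernel.condition]
      hπ := CokernelCofork.IsColimit.ofπ _ _ (fun g hg => cokernel.desc _ g (by rwa [← hf]))
        (fun g hg => cokernel.π_desc _ _ _)
        (fun g hg m hm => by rw [← cancel_epi (cokernel.π _), hm, cokernel.π_desc]) }
  let e : K.sc' 0 1 2 ≅ s := Iso.refl _
  exact (hS.projectiveResolution Q).isoExt 1 V ≪≫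
    (ShortComplex.homologyMapIso (K.isoSc' 0 1 2 (by simp) (by simp) ≪≫ e)) ≪≫ d.homologyIso

end CategoryTheory.ShortComplex.ShortExact

/-- Restriction of scalars along a surjective ring homomorphism is full. -/
lemma ModuleCat.restrictScalars_full {R S : Type*} [Ring R] [Ring S] (f : R →+* S)
    (hf : Function.Surjective f) : (ModuleCat.restrictScalars.{v} f).Full where
  map_surjective {M N} φ := ⟨ModuleCat.ofHom
    { toFun := φ.hom
      map_add' := φ.hom.map_add
      map_smul' := fun s x => by
        obtain ⟨r, rfl⟩ := hf s
        exact φ.hom.map_smul r x }, rfl⟩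

/-- The cokernel of precomposition with a morphism is invariant under fully faithful additive
functors. -/
lemma CategoryTheory.Functor.nonempty_cokernel_linearYoneda_map_iso
    {C : Type u} {D : Type u'} [Category.{v} C] [Category.{v} D] [Preadditive C] [Preadditive D]
    (F : C ⥤ D) [F.Additive] [F.Full] [F.Faithful] {X Y : C} (f : X ⟶ Y) (V : C) :
    Nonempty (cokernel (((linearYoneda ℤ D).obj (F.obj V)).map (F.map f).op) ≅
      cokernel (((linearYoneda ℤ C).obj V).map f.op)) := by
  let e (X : C) : ((linearYoneda ℤ C).obj V).obj (Opposite.op X) ≅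
      ((linearYoneda ℤ D).obj (F.obj V)).obj (Opposite.op (F.obj X)) :=
    (AddEquiv.toIntLinearEquiv
      { (Functor.FullyFaithful.ofFullyFaithful F).homEquiv (X := X) (Y := V) with
        map_add' := fun _ _ => F.map_add }).toModuleIso
  refine ⟨cokernel.mapIso _ _ (e Y).symm (e X).symm ?_⟩
  rw [Iso.symm_hom, Iso.symm_hom, Iso.comp_inv_eq, Category.assoc, Iso.eq_inv_comp]
  ext φ
  exact (F.map_comp f φ).symm

/-- let `J` be a two-sided ideal of a ring `A`, and `Y`, `V` left
`A/J`-modules, regarded as `A`-modules by restriction along `A → A/J`.  If there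
is a short exact sequence `0 → L → P → Y → 0` of `A/J`-modules with `P`
projective both over `A/J` and over `A`, then `Ext¹_A(Y, V) ≅ Ext¹_{A/J}(Y, V)`
as abelian groups. -/
theorem ext_one_quotient_iso
    {A : Type} [Ring A] (J : TwoSidedIdeal A)
    (Y V L P : ModuleCat J.ringCon.Quotient)
    (f : L ⟶ P) (g : P ⟶ Y)
    (hf : Function.Injective f) (hg : Function.Surjective g)
    (hfg : Function.Exact f g)
    (hP : Projective P)
    (hPA : Projective ((ModuleCat.restrictScalars J.ringCon.mk').obj P)) :
    Nonempty
      ((((Ext ℤ (ModuleCat A) 1).obj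
            (Opposite.op ((ModuleCat.restrictScalars J.ringCon.mk').obj Y))).obj
          ((ModuleCat.restrictScalars J.ringCon.mk').obj V)) ≃+
        (((Ext ℤ (ModuleCat J.ringCon.Quotient) 1).obj (Opposite.op Y)).obj V)) := by
  let F : ModuleCat J.ringCon.Quotient ⥤ ModuleCat A := ModuleCat.restrictScalars J.ringCon.mk'
  have : F.Full := ModuleCat.restrictScalars_full _ J.ringCon.mk'_surjective
  let S : ShortComplex (ModuleCat J.ringCon.Quotient) :=
    ShortComplex.mk f g (by ext x; exact hfg.apply_apply_eq_zero x)
  have hS : S.ShortExact :=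
    { exact := (ShortComplex.moduleCat_exact_iff S).2 fun x hx => (hfg x).1 hx
      mono_f := (ModuleCat.mono_iff_injective f).2 hf
      epi_g := (ModuleCat.epi_iff_surjective g).2 hg }
  have hSF : (S.map F).ShortExact :=
    { exact := (ShortComplex.moduleCat_exact_iff (S.map F)).2 fun x hx => (hfg x).1 hx
      mono_f := (ModuleCat.mono_iff_injective (F.map f)).2 hf
      epi_g := (ModuleCat.epi_iff_surjective (F.map g)).2 hg }
  have : Projective S.X₂ := hP
  have : Projective (S.map F).X₂ := hPA
  obtain ⟨e⟩ := F.nonempty_cokernel_linearYoneda_map_iso f V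
  exact ⟨(hSF.extOneIso ℤ (F.obj V) ≪≫ e ≪≫
    (hS.extOneIso ℤ V).symm).toLinearEquiv.toAddEquiv⟩
end
end

section
/- Let A be a ring and J a two-sided ideal of A, and let Y and V be left A/J-modules, regarded also as A-modules by restriction along the quotient map A → A/J. Let m ≥ 0 and suppose there is an exact sequence of A/J-modules 0 → K → M_m → M_{m-1} → ⋯ → M_1 → M_0 → Y → 0 in which each M_i (0 ≤ i ≤ m) is projective both as an A/J-module and as an A-module. Then Ext^i_A(Y, V) ≅ Ext^i_{A/J}(Y, V) as abelian groups for all i with 0 ≤ i ≤ m + 1. -/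
open CategoryTheory

noncomputable section

namespace CategoryTheory

open Limits Abelian

section mapExt

universe w w' v v' u u'

variable {C : Type u} [Category.{v} C] [Abelian C] {D : Type u'} [Category.{v'} D] [Abelian D]
  (F : C ⥤ D) [F.Additive] [PreservesFiniteLimits F] [PreservesFiniteColimits F]
  [HasExt.{w} C] [HasExt.{w'} D] [F.Full] [F.Faithful]

lemma Functor.mapExtAddHom_zero_bijective (X Y : C) :
    Function.Bijective (F.mapExtAddHom X Y 0) := by
  simpa [Ext.mapExactFunctor₀] using ⟨Functor.Faithful.map_injective, Functor.Full.map_surjective⟩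

attribute [local simp] Ext.mapExactFunctor_comp Ext.mapExactFunctor_mk₀ Ext.mapExactFunctor_extClass

attribute [local instance] Ext.subsingleton_of_projective in
/-- Dimension shifting for the maps induced on `Ext` by a fully faithful exact functor `F`, along a
short exact sequence whose middle term is projective and has projective image under `F`. -/
lemma Functor.mapExtAddHom_succ_bijective {S : ShortComplex C} (hS : S.ShortExact)
    [Projective S.X₂] [Projective (F.obj S.X₂)] (Y : C) (n : ℕ)
    (h : Function.Bijective (F.mapExtAddHom S.X₁ Y n)) :
    Function.Bijective (F.mapExtAddHom S.X₃ Y (n + 1)) := by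
  have := hS.mono_f
  have := hS.epi_g
  have : Projective (S.map F).X₂ := ‹Projective (F.obj S.X₂)›
  have h₂ : Function.Surjective (F.mapExtAddHom S.X₂ Y n) := by
    cases n with
    | zero => exact (F.mapExtAddHom_zero_bijective _ _).surjective
    | succ n => exact Function.surjective_to_subsingleton _
  exact AddMonoidHom.bijective_of_surjective_of_bijective_of_right_exact _ _ _ _
    (F.mapExtAddHom S.X₂ Y n) (F.mapExtAddHom S.X₁ Y n) (F.mapExtAddHom S.X₃ Y (n + 1))
    (by cat_disch) (by cat_disch)
    ((ShortComplex.ab_exact_iff_function_exact _).1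
      (Ext.contravariant_sequence_exact₁' hS Y n (n + 1) (add_comm 1 n)))
    ((ShortComplex.ab_exact_iff_function_exact _).1
      (Ext.contravariant_sequence_exact₁' (hS.map F) (F.obj Y) n (n + 1) (add_comm 1 n)))
    h₂ h
    (fun x₃ ↦ Ext.contravariant_sequence_exact₃ hS _ x₃ (by subsingleton) (add_comm 1 n))
    (fun y₃ ↦ Ext.contravariant_sequence_exact₃ (hS.map F) _ y₃ (by subsingleton) (add_comm 1 n))

end mapExt

section comparison

universe w v u

variable {C : Type u} [Category.{v} C] [Abelian C] [HasExt.{w} C] {X Y : C}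

namespace ProjectiveResolution

lemma extMk_zero_eq_zero_iff (P : ProjectiveResolution X) (f : P.complex.X 0 ⟶ Y) (m : ℕ)
    (hm : 0 + 1 = m) (hf : P.complex.d m 0 ≫ f = 0) :
    P.extMk f m hm hf = 0 ↔ f = 0 := by
  refine ⟨fun h ↦ ?_, fun h ↦ by subst h; simp⟩
  rw [← P.extEquivCohomologyClass.apply_eq_iff_eq, extEquivCohomologyClass_extMk,
    extEquivCohomologyClass_zero, CochainComplex.HomComplex.CohomologyClass.mk_eq_zero_iff,
    CochainComplex.HomComplex.Cocycle.toSingleMk_mem_coboundaries_iff _ _ _ _ _ 1 (by lia)] at h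
  obtain ⟨g, hg⟩ := h
  have hz : IsZero (P.cochainComplex.X 1) := P.cochainComplex.isZero_of_isStrictlyLE 0 1
  rw [hz.eq_of_src g 0, comp_zero] at hg
  rw [← cancel_epi (P.cochainComplexXIso (-(0 : ℕ)) 0 rfl).hom, comp_zero]
  exact hg.symm

/-- The class in `Abelian.Ext X Y n` of a cocycle in the complex of morphisms from a projective
resolution of `X` to `Y`. -/
def extOfCocycle (P : ProjectiveResolution X) (Y : C) (n : ℕ) :
    LinearMap.ker ((P.complex.linearYonedaObj ℤ Y).sc n).g.hom →+ Abelian.Ext X Y n where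
  toFun f := P.extMk (Y := Y) f.1 ((ComplexShape.up ℕ).next n) (by simp) f.2
  map_zero' := by exact P.extMk_zero _ _
  map_add' f g := by exact (P.add_extMk _ _ _ _ _ _).symm

lemma extOfCocycle_surjective (P : ProjectiveResolution X) (Y : C) (n : ℕ) :
    Function.Surjective (P.extOfCocycle Y n) := fun α ↦ by
  obtain ⟨f, hf, rfl⟩ := P.extMk_surjective α ((ComplexShape.up ℕ).next n) (by simp)
  exact ⟨⟨f, hf⟩, rfl⟩

lemma extOfCocycle_eq_zero_iff (P : ProjectiveResolution X) (Y : C) (n : ℕ)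
    (f : LinearMap.ker ((P.complex.linearYonedaObj ℤ Y).sc n).g.hom) :
    P.extOfCocycle Y n f = 0 ↔
      f ∈ LinearMap.range ((P.complex.linearYonedaObj ℤ Y).sc n).moduleCatToCycles := by
  obtain ⟨f, hf⟩ := f
  trans ∃ g, ((P.complex.linearYonedaObj ℤ Y).sc n).f.hom g = f
  · cases n with
    | zero =>
      have h0 : ((P.complex.linearYonedaObj ℤ Y).sc 0).f = 0 :=
        (P.complex.linearYonedaObj ℤ Y).shape ((ComplexShape.up ℕ).prev 0) 0 (by simp)
      refine (P.extMk_zero_eq_zero_iff f _ (by simp) hf).trans ?_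
      rw [h0]
      exact ⟨fun h ↦ ⟨0, h.symm⟩, fun ⟨_, h⟩ ↦ h.symm⟩
    | succ p =>
      exact P.extMk_eq_zero_iff f _ (by simp) hf ((ComplexShape.up ℕ).prev (p + 1)) (by simp)
  · exact ⟨fun ⟨g, h⟩ ↦ ⟨g, Subtype.ext h⟩, fun ⟨g, h⟩ ↦ ⟨g, congrArg Subtype.val h⟩⟩

/-- The cohomology of the complex of morphisms from a projective resolution of `X` to `Y` is
`Abelian.Ext X Y n`. -/
def homologyAddEquivExt (P : ProjectiveResolution X) (Y : C) (n : ℕ) :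
    (P.complex.linearYonedaObj ℤ Y).homology n ≃+ Abelian.Ext X Y n :=
  ((P.complex.linearYonedaObj ℤ Y).sc n).moduleCatHomologyIso.toLinearEquiv.toAddEquiv.trans <|
    (QuotientAddGroup.quotientAddEquivOfEq (by
      ext f
      exact (P.extOfCocycle_eq_zero_iff Y n f).symm)).trans
    (QuotientAddGroup.quotientKerEquivOfSurjective _ (P.extOfCocycle_surjective Y n))

end ProjectiveResolution

/-- The `Ext` groups defined by deriving `Hom` in the first variable agree with those defined using
the derived category. -/
def extAddEquivAbelianExt [EnoughProjectives C] (X Y : C) (n : ℕ) :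
    ((_root_.Ext ℤ C n).obj (Opposite.op X)).obj Y ≃+ Abelian.Ext X Y n :=
  ((projectiveResolution X).isoExt n Y).toLinearEquiv.toAddEquiv.trans
    ((projectiveResolution X).homologyAddEquivExt Y n)

end comparison

end CategoryTheory

namespace ModuleCat

open Limits

universe v u u'

variable {R : Type u} {S : Type u'} [Ring R] [Ring S]

instance restrictScalars_preservesFiniteLimits (f : R →+* S) :
    PreservesFiniteLimits (restrictScalars.{v} f) where
  preservesFiniteLimits _ _ _ := { preservesLimit := inferInstance }

lemma restrictScalars_full_s6 {f : R →+* S} (hf : Function.Surjective f) :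
    (restrictScalars.{v} f).Full where
  map_surjective {M N} g := by
    refine ⟨ofHom { toFun := g.hom, map_add' := g.hom.map_add, map_smul' := fun s x ↦ ?_ }, rfl⟩
    obtain ⟨r, rfl⟩ := hf s
    exact g.hom.map_smul r x

universe w w'

lemma mapExtAddHom_bijective_of_projective_resolution [HasExt.{w} (ModuleCat.{v} R)]
    {D : Type u'} [Category.{v} D] [Abelian D] [HasExt.{w'} D] (F : ModuleCat.{v} R ⥤ D)
    [F.Additive] [PreservesFiniteLimits F] [PreservesFiniteColimits F] [F.Full] [F.Faithful]
    (V : ModuleCat.{v} R) (i m : ℕ) (him : i ≤ m + 1) (Y : ModuleCat.{v} R)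
    (N : ℕ → ModuleCat.{v} R) (d : ∀ i : ℕ, N (i + 1) ⟶ N i) (ε : N 0 ⟶ Y)
    (hε : Function.Surjective ε) (hex0 : Function.Exact (d 0) ε)
    (hex : ∀ i : ℕ, i < m → Function.Exact (d (i + 1)) (d i))
    (hproj : ∀ i : ℕ, i ≤ m → Projective (N i))
    (hprojF : ∀ i : ℕ, i ≤ m → Projective (F.obj (N i))) :
    Function.Bijective (F.mapExtAddHom Y V i) := by
  induction i generalizing m Y N with
  | zero => exact F.mapExtAddHom_zero_bijective _ _
  | succ i ih =>
    let S : ShortComplex (ModuleCat.{v} R) :=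
      .mk (ofHom (LinearMap.ker ε.hom).subtype) ε (by ext x; exact x.2)
    have hS : S.ShortExact :=
      { exact := (ShortComplex.ShortExact.moduleCat_exact_iff_function_exact S).2
          (LinearMap.exact_subtype_ker_map ε.hom)
        mono_f := (mono_iff_injective _).2 Subtype.val_injective
        epi_g := (epi_iff_surjective _).2 hε }
    have : Projective S.X₂ := hproj 0 (by lia)
    have : Projective (F.obj S.X₂) := hprojF 0 (by lia)
    refine F.mapExtAddHom_succ_bijective hS V i ?_
    obtain _ | m := m
    · obtain rfl : i = 0 := by lia
      exact F.mapExtAddHom_zero_bijective _ _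
    · refine ih m (by lia) S.X₁ (fun j ↦ N (j + 1)) (fun j ↦ d (j + 1))
        (ofHom ((d 0).hom.codRestrict (LinearMap.ker ε.hom) hex0.apply_apply_eq_zero))
        ?_ ?_ (fun j hj ↦ hex (j + 1) (by lia)) (fun j hj ↦ hproj (j + 1) (by lia))
        (fun j hj ↦ hprojF (j + 1) (by lia))
      · rintro ⟨x, hx⟩
        obtain ⟨y, rfl⟩ := (hex0 x).1 hx
        exact ⟨y, rfl⟩
      · exact fun x ↦ Subtype.ext_iff.trans (hex 0 (by lia) x)

end ModuleCat
/-- let `J` be a two-sided ideal of a ring `A`, and `Y`, `V` left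
`A/J`-modules, regarded as `A`-modules by restriction along `A → A/J`.  Suppose
there is an exact sequence of `A/J`-modules
`0 → K → M_m → ⋯ → M_1 → M_0 → Y → 0` in which each `M_i` (`0 ≤ i ≤ m`) is
projective both over `A/J` and over `A`.  (Below, `N i = M_i` for `i ≤ m` and
`N (m+1) = K`.)  Then `Extⁱ_A(Y, V) ≅ Extⁱ_{A/J}(Y, V)` as abelian groups for
`0 ≤ i ≤ m + 1`. -/
theorem ext_quotient_iso
    {A : Type} [Ring A] (J : TwoSidedIdeal A) (m : ℕ)
    (Y V : ModuleCat J.ringCon.Quotient)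
    (N : ℕ → ModuleCat J.ringCon.Quotient)
    (d : ∀ i : ℕ, N (i + 1) ⟶ N i) (ε : N 0 ⟶ Y)
    (hε : Function.Surjective ε)
    (hex0 : Function.Exact (d 0) ε)
    (hex : ∀ i : ℕ, i < m → Function.Exact (d (i + 1)) (d i))
    (hK : Function.Injective (d m))
    (hproj : ∀ i : ℕ, i ≤ m → Projective (N i))
    (hprojA : ∀ i : ℕ, i ≤ m →
      Projective ((ModuleCat.restrictScalars J.ringCon.mk').obj (N i))) :
    ∀ i : ℕ, i ≤ m + 1 →
      Nonempty
        ((((Ext ℤ (ModuleCat A) i).obj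
              (Opposite.op ((ModuleCat.restrictScalars J.ringCon.mk').obj Y))).obj
            ((ModuleCat.restrictScalars J.ringCon.mk').obj V)) ≃+
          (((Ext ℤ (ModuleCat J.ringCon.Quotient) i).obj (Opposite.op Y)).obj V)) := by
  intro i hi
  have := ModuleCat.restrictScalars_full_s6.{0} J.ringCon.mk'_surjective
  exact ⟨(extAddEquivAbelianExt _ _ i).trans <|
    (AddEquiv.ofBijective _
      (ModuleCat.mapExtAddHom_bijective_of_projective_resolution
        (ModuleCat.restrictScalars J.ringCon.mk') V i m hi Y N d ε hε hex0 hex hproj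
        hprojA)).symm.trans (extAddEquivAbelianExt _ _ i).symm⟩
end
end
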